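/- arXiv:0711.3927 — 7 statements merged into one kernel-verified Lean document; each statement's English description precedes it below -/
import Mathlib

section
/- Let V be a finite-dimensional vector space over ℚ equipped with a symmetric bilinear form B, and let G be a group generated by elements g₁,…,gₙ acting ℚ-linearly on V. Suppose there are vectors e₁,…,eₙ ∈ V with B(eᵢ,eᵢ) = 2 for every i, and the action satisfies gᵢ · v = v − B(v,eᵢ)·eᵢ for all v ∈ V and all i. Then every 1-cocycle φ : G → V with the property that for each g ∈ G there exists v ∈ V with φ(g) = g·v − v, is a 1-coboundary. Equivalently, the restriction map H¹(G,V) → ∏_{g ∈ G} V/(g − id)V, sending the class of a 1-cocycle φ to the family of classes φ(g) + (g − id)V, is injective. -/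
section

variable {k V G ι : Type*} [Field k] [AddCommGroup V] [Module k V] [Group G]

/-- A function `φ : G → V` is a 1-cocycle for the linear action `ρ` of `G` on `V`. -/
def IsLinearCocycle (ρ : G →* Module.End k V) (φ : G → V) : Prop :=
  ∀ x y : G, φ (x * y) = ρ x (φ y) + φ x

namespace IsLinearCocycle

variable {ρ : G →* Module.End k V} {φ ψ : G → V}

theorem coboundary (ρ : G →* Module.End k V) (w : V) :
    IsLinearCocycle ρ fun x => ρ x w - w := by
  intro x y
  simp

theorem sub (hφ : IsLinearCocycle ρ φ) (hψ : IsLinearCocycle ρ ψ) :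
    IsLinearCocycle ρ (φ - ψ) := by
  intro x y
  simp only [Pi.sub_apply, hφ x y, hψ x y, map_sub]
  abel

theorem map_one (hφ : IsLinearCocycle ρ φ) : φ 1 = 0 := by
  simpa using hφ 1 1

theorem eq_zero_of_closure_eq_top (hφ : IsLinearCocycle ρ φ) {S : Set G}
    (hS : Subgroup.closure S = ⊤) (h : ∀ s ∈ S, φ s = 0) (x : G) : φ x = 0 := by
  have hx : x ∈ Subgroup.closure S := hS ▸ Subgroup.mem_top x
  induction hx using Subgroup.closure_induction with
  | mem s hs => exact h s hs
  | one => exact hφ.map_one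
  | mul x y _ _ hx hy => rw [hφ, hx, hy, map_zero, add_zero]
  | inv x _ hx =>
    have := hφ x⁻¹ x
    rwa [inv_mul_cancel, hφ.map_one, hx, map_zero, zero_add, eq_comm] at this

end IsLinearCocycle

/-- If `G` is generated by isometries of `B`, then it acts by isometries. -/
theorem bilinForm_apply_of_closure_eq_top {ρ : G →* Module.End k V}
    {B : LinearMap.BilinForm k V} {S : Set G} (hS : Subgroup.closure S = ⊤)
    (h : ∀ s ∈ S, ∀ u v, B (ρ s u) (ρ s v) = B u v) (x : G) (u v : V) :
    B (ρ x u) (ρ x v) = B u v := by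
  have hx : x ∈ Subgroup.closure S := hS ▸ Subgroup.mem_top x
  induction hx using Subgroup.closure_induction generalizing u v with
  | mem s hs => exact h s hs u v
  | one => simp
  | mul x y _ _ hx hy => simp [hx, hy]
  | inv x _ hx => rw [← hx]; simp [← Module.End.mul_apply, ← map_mul]

/-- Among finitely many elements `g i` acting by `v ↦ v - B v (e i) • e i` one can pick a
subfamily `t` whose vectors span the same subspace, and a product `h` of its members, such that
every cocycle which maps each `g i` to a multiple of `e i` and vanishes at `h` vanishes on `t`. -/
theorem exists_subset_span_eq_and_eq_zero_of_eq_zero {ρ : G →* Module.End k V}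
    {B : LinearMap.BilinForm k V} {g : ι → G} {e : ι → V}
    (hact : ∀ i v, ρ (g i) v = v - B v (e i) • e i) (s : Finset ι) :
    ∃ t : Set ι, Submodule.span k (e '' t) = Submodule.span k (e '' s) ∧
      ∃ h : G, ∀ φ : G → V, IsLinearCocycle ρ φ → (∀ i, ∃ c : k, φ (g i) = c • e i) →
        φ h ∈ Submodule.span k (e '' t) ∧ (φ h = 0 → ∀ i ∈ t, φ (g i) = 0) := by
  classical
  induction s using Finset.induction_on with
  | empty => exact ⟨∅, by simp, 1, fun φ hφ _ => by simp [hφ.map_one]⟩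
  | insert j s _ ih =>
    obtain ⟨t, hts, h, hh⟩ := ih
    by_cases hj : e j ∈ Submodule.span k (e '' t)
    · refine ⟨t, ?_, h, hh⟩
      rw [Finset.coe_insert, Set.image_insert_eq, Submodule.span_insert_eq_span (hts ▸ hj), hts]
    · refine ⟨insert j t, ?_, g j * h, fun φ hφ hc => ?_⟩
      · rw [Finset.coe_insert, Set.image_insert_eq, Set.image_insert_eq, Submodule.span_insert,
          Submodule.span_insert, hts]
      · obtain ⟨hmem, hzero⟩ := hh φ hφ hc
        obtain ⟨c, hcj⟩ := hc j
        have hval : φ (g j * h) = φ h + (c - B (φ h) (e j)) • e j := by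
          rw [hφ, hact, hcj, sub_smul]
          abel
        constructor
        · rw [hval, Set.image_insert_eq]
          exact add_mem (Submodule.span_mono (Set.subset_insert _ _) hmem)
            (Submodule.smul_mem _ _ (Submodule.subset_span (Set.mem_insert _ _)))
        · intro h0
          rw [hval] at h0
          have ha : c - B (φ h) (e j) = 0 := by
            by_contra ha
            refine hj ((Submodule.smul_mem_iff _ ha).1 ?_)
            rw [eq_neg_of_add_eq_zero_right h0]
            exact neg_mem hmem
          have hφh : φ h = 0 := by simpa [ha] using h0
          rintro i (rfl | hi)
          · have : c = 0 := by simpa [hφh] using ha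
            rw [hcj, this, zero_smul]
          · exact hzero hφh i hi

end


/-- Let `V` be a finite-dimensional `ℚ`-vector space with a symmetric
bilinear form `B`, and let `G` be a group generated by `g₁, …, gₙ` acting `ℚ`-linearly
on `V`, with vectors `e₁, …, eₙ` satisfying `B(eᵢ, eᵢ) = 2` and
`gᵢ · v = v - B(v, eᵢ) • eᵢ`.  Then every 1-cocycle `φ : G → V` whose value `φ(g)` lies
in `(g - id) V` for every `g ∈ G` is a 1-coboundary; equivalently, the restriction map
`H¹(G, V) → ∏_{g ∈ G} V/(g - id)V` is injective. -/
theorem stmt0 (V : Type*) [AddCommGroup V] [Module ℚ V] [FiniteDimensional ℚ V]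
    (B : LinearMap.BilinForm ℚ V) (hBsymm : ∀ u v : V, B u v = B v u)
    (G : Type*) [Group G] (ρ : G →* Module.End ℚ V)
    (n : ℕ) (g : Fin n → G) (e : Fin n → V)
    (hgen : Subgroup.closure (Set.range g) = ⊤)
    (he : ∀ i, B (e i) (e i) = 2)
    (hact : ∀ (i : Fin n) (v : V), ρ (g i) v = v - B v (e i) • e i)
    (φ : G → V)
    (hcocycle : ∀ x y : G, φ (x * y) = ρ x (φ y) + φ x)
    (hker : ∀ x : G, ∃ v : V, φ x = ρ x v - v) :
    ∃ w : V, ∀ x : G, φ x = ρ x w - w := by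
  have hφ : IsLinearCocycle ρ φ := hcocycle
  have hne : ∀ i, e i ≠ 0 := fun i h => by simpa [h] using he i
  have hcob : ∀ w i, ∃ c : ℚ, ρ (g i) w - w = c • e i := fun w i =>
    ⟨-B w (e i), by rw [hact, neg_smul]; abel⟩
  have hisom : ∀ x u v, B (ρ x u) (ρ x v) = B u v := by
    refine bilinForm_apply_of_closure_eq_top hgen ?_
    rintro _ ⟨i, rfl⟩ u v
    simp only [hact, map_sub, map_smul, LinearMap.sub_apply, LinearMap.smul_apply, smul_eq_mul,
      he, hBsymm (e i) v]
    ring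
  obtain ⟨t, hspan, h, hh⟩ := exists_subset_span_eq_and_eq_zero_of_eq_zero hact Finset.univ
  have hfix : ∀ w, ρ h w = w → ∀ j, B w (e j) = 0 := by
    intro w hw j
    have ht := (hh _ (.coboundary ρ w) (hcob w)).2 (sub_eq_zero.2 hw)
    have hle : Submodule.span ℚ (e '' t) ≤ LinearMap.ker (B w) := by
      rw [Submodule.span_le]
      rintro _ ⟨i, hi, rfl⟩
      simpa [hact, hne i] using ht i hi
    exact hle (hspan ▸ Submodule.subset_span ⟨j, by simp, rfl⟩)
  obtain ⟨v, hv⟩ := hker h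
  set ψ : G → V := φ - fun x => ρ x v - v with hψ_def
  have hψ : IsLinearCocycle ρ ψ := hφ.sub (.coboundary ρ v)
  have hψh : ψ h = 0 := by simp [hψ_def, hv]
  have hψker : ∀ x, ∃ w, ψ x = ρ x w - w := by
    intro x
    obtain ⟨u, hu⟩ := hker x
    refine ⟨u - v, ?_⟩
    simp only [hψ_def, Pi.sub_apply, hu, map_sub]
    abel
  have hψg : ∀ j, ψ (g j) = 0 := by
    intro j
    obtain ⟨c, hc⟩ : ∃ c : ℚ, ψ (g j) = c • e j := by
      obtain ⟨w, hw⟩ := hψker (g j)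
      exact hw ▸ hcob w j
    obtain ⟨w, hw⟩ := hψker (g j * h)
    have hrefl : ∀ u, ρ (g j) (ρ (g j) u) = u := by
      intro u
      simp only [hact, map_sub, map_smul, LinearMap.sub_apply, LinearMap.smul_apply, smul_eq_mul,
        he]
      module
    have hhw : ρ h w = w + (-B w (e j) - c) • e j := by
      have h1 : ρ (g j) (ρ h w) = w + c • e j := by
        rw [hψ, hψh, map_zero, zero_add, hc, map_mul, Module.End.mul_apply] at hw
        rw [hw]
        abel
      rw [← hrefl (ρ h w), h1, hact]
      simp only [map_add, map_smul, LinearMap.add_apply, LinearMap.smul_apply, smul_eq_mul, he]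
      module
    have hc0 : c = 0 := by
      by_cases hs : -B w (e j) - c = 0
      · have := hfix w (by rw [hhw, hs, zero_smul, add_zero]) j
        linarith
      · have hnorm := hisom h w w
        rw [hhw] at hnorm
        simp only [map_add, map_smul, LinearMap.add_apply, LinearMap.smul_apply, smul_eq_mul, he,
          hBsymm (e j) w] at hnorm
        have : (-B w (e j) - c) * c = 0 := by linear_combination -hnorm / 2
        exact (mul_eq_zero.1 this).resolve_left hs
    rw [hc, hc0, zero_smul]
  refine ⟨v, fun x => sub_eq_zero.1 ?_⟩
  exact hψ.eq_zero_of_closure_eq_top hgen (by rintro _ ⟨j, rfl⟩; exact hψg j) x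
end

section
/- Let G = ℤ² act on M = ℚ³ by letting the two standard generators act through the commuting matrices A₁ = [[1,0,1],[0,1,0],[0,0,1]] and A₂ = [[1,2,2],[0,1,2],[0,0,1]] (so (a,b) ∈ ℤ² acts as A₁ᵃA₂ᵇ). Define φ : G → M by φ(a,b) = (a,0,0). Then: (1) φ is a 1-cocycle; (2) φ is not a 1-coboundary; and (3) for every g ∈ G, the value φ(g) lies in (g − id)M. Consequently the restriction map H¹(G,M) → ∏_{g ∈ G} M/(g − id)M is not injective. -/
/-- The upper unitriangular representation of `ℤ²` on `ℚ³` in which `(a, b)` acts by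
`[[1, 2b, a + 2b²], [0, 1, 2b], [0, 0, 1]]`. -/
def unitriangularRep : Multiplicative (ℤ × ℤ) →* Module.End ℚ (Fin 3 → ℚ) where
  toFun x := Matrix.mulVecLin !![(1 : ℚ), 2 * x.toAdd.2, x.toAdd.1 + 2 * x.toAdd.2 ^ 2;
    0, 1, 2 * x.toAdd.2; 0, 0, 1]
  map_one' := by
    refine LinearMap.ext fun v => funext fun i => ?_
    fin_cases i <;> simp [Matrix.mulVec, dotProduct, Fin.sum_univ_three]
  map_mul' x y := by
    refine LinearMap.ext fun v => funext fun i => ?_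
    fin_cases i <;> simp [Matrix.mulVec, dotProduct, Fin.sum_univ_three] <;> ring

theorem unitriangularRep_ofAdd_apply (a b : ℤ) (v : Fin 3 → ℚ) :
    unitriangularRep (Multiplicative.ofAdd (a, b)) v =
      ![v 0 + 2 * b * v 1 + (a + 2 * b ^ 2) * v 2, v 1 + 2 * b * v 2, v 2] := by
  funext i
  fin_cases i <;>
    simp [unitriangularRep, Matrix.mulVec, dotProduct, Fin.sum_univ_three]

/-- Homomorphisms out of `ℤ²`, written multiplicatively, agree if they agree on the two
standard generators. -/
theorem monoidHom_multiplicative_int_prod_ext {N : Type*} [Monoid N]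
    {f g : Multiplicative (ℤ × ℤ) →* N}
    (h₁ : f (Multiplicative.ofAdd ((1 : ℤ), (0 : ℤ))) = g (Multiplicative.ofAdd (1, 0)))
    (h₂ : f (Multiplicative.ofAdd ((0 : ℤ), (1 : ℤ))) = g (Multiplicative.ofAdd (0, 1))) :
    f = g := by
  have hl : f.comp (AddMonoidHom.toMultiplicative (AddMonoidHom.inl ℤ ℤ)) =
      g.comp (AddMonoidHom.toMultiplicative (AddMonoidHom.inl ℤ ℤ)) :=
    MonoidHom.ext_mint h₁
  have hr : f.comp (AddMonoidHom.toMultiplicative (AddMonoidHom.inr ℤ ℤ)) =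
      g.comp (AddMonoidHom.toMultiplicative (AddMonoidHom.inr ℤ ℤ)) :=
    MonoidHom.ext_mint h₂
  refine MonoidHom.ext fun x => ?_
  obtain ⟨⟨a, b⟩, rfl⟩ := Multiplicative.ofAdd.surjective x
  have hab : Multiplicative.ofAdd (a, b) =
      Multiplicative.ofAdd (a, (0 : ℤ)) * Multiplicative.ofAdd ((0 : ℤ), b) := by
    simp [← ofAdd_add]
  rw [hab, map_mul, map_mul]
  exact congrArg₂ (· * ·) (DFunLike.congr_fun hl (Multiplicative.ofAdd a))
    (DFunLike.congr_fun hr (Multiplicative.ofAdd b))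

/-- Let `G = ℤ²` act on `M = ℚ³` through the commuting unipotent
matrices `A₁ = [[1,0,1],[0,1,0],[0,0,1]]` and `A₂ = [[1,2,2],[0,1,2],[0,0,1]]`
(the generators `(1,0)` and `(0,1)` act by `A₁` and `A₂`, so `(a,b)` acts as `A₁ᵃA₂ᵇ`).
Define `φ : G → M` by `φ(a,b) = (a,0,0)`.  Then (1) `φ` is a 1-cocycle, (2) `φ` is not
a 1-coboundary, and (3) for every `g ∈ G` the value `φ(g)` lies in `(g - id) M`.
Consequently the restriction map `H¹(G,M) → ∏_g M/(g-id)M` is not injective. -/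
theorem stmt2
    (ρ : Multiplicative (ℤ × ℤ) →* Module.End ℚ (Fin 3 → ℚ))
    (h1 : ρ (Multiplicative.ofAdd ((1 : ℤ), (0 : ℤ))) =
      Matrix.mulVecLin !![(1:ℚ), 0, 1; 0, 1, 0; 0, 0, 1])
    (h2 : ρ (Multiplicative.ofAdd ((0 : ℤ), (1 : ℤ))) =
      Matrix.mulVecLin !![(1:ℚ), 2, 2; 0, 1, 2; 0, 0, 1])
    (φ : Multiplicative (ℤ × ℤ) → (Fin 3 → ℚ))
    (hφ : ∀ p : ℤ × ℤ, φ (Multiplicative.ofAdd p) = ![(p.1 : ℚ), 0, 0]) :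
    (∀ x y : Multiplicative (ℤ × ℤ), φ (x * y) = ρ x (φ y) + φ x) ∧
    (¬ ∃ m : Fin 3 → ℚ, ∀ x : Multiplicative (ℤ × ℤ), φ x = ρ x m - m) ∧
    (∀ x : Multiplicative (ℤ × ℤ), ∃ m : Fin 3 → ℚ, φ x = ρ x m - m) := by
  obtain rfl : ρ = unitriangularRep := by
    apply monoidHom_multiplicative_int_prod_ext
    · rw [h1]; simp [unitriangularRep]
    · rw [h2]; simp [unitriangularRep]
  refine ⟨fun x y => ?_, ?_, fun x => ?_⟩
  · obtain ⟨⟨a, b⟩, rfl⟩ := Multiplicative.ofAdd.surjective x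
    obtain ⟨⟨c, d⟩, rfl⟩ := Multiplicative.ofAdd.surjective y
    rw [← ofAdd_add, hφ, hφ, hφ, unitriangularRep_ofAdd_apply]
    simp [add_comm]
  · rintro ⟨m, hm⟩
    have e₁ := congrFun (hm (Multiplicative.ofAdd (1, 0))) 0
    have e₂ := congrFun (hm (Multiplicative.ofAdd (0, 1))) 1
    rw [hφ, unitriangularRep_ofAdd_apply] at e₁ e₂
    simp at e₁ e₂
    simp [e₂] at e₁
  · obtain ⟨⟨a, b⟩, rfl⟩ := Multiplicative.ofAdd.surjective x
    rw [hφ]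
    rcases eq_or_ne b 0 with rfl | hb
    · refine ⟨![0, 0, 1], ?_⟩
      rw [unitriangularRep_ofAdd_apply]
      simp
    · have hb' : (b : ℚ) ≠ 0 := Int.cast_ne_zero.mpr hb
      refine ⟨![0, a / (2 * b), 0], ?_⟩
      rw [unitriangularRep_ofAdd_apply]
      simp
      field_simp
end

section
/- Let V be a free ℤ-module of finite rank with an alternating bilinear form B, and let G be a group generated by elements g₁,…,gₙ acting on V, with distinguished elements e₁,…,eₙ ∈ V such that gᵢ · v = v − B(v,eᵢ)·eᵢ = T_{eᵢ}(v) for all v ∈ V and all i. Assume that the orbit set Δ = G · {e₁,…,eₙ} is a skew-symmetric vanishing lattice in V. Let V_ℚ = V ⊗ ℚ with the induced G-action. Then every 1-cocycle φ : G → V_ℚ with the property that for each g ∈ G there exists v ∈ V_ℚ with φ(g) = g·v − v, is a 1-coboundary. Equivalently, the restriction map H¹(G, V_ℚ) → ∏_{g ∈ G} V_ℚ/(g − id)V_ℚ is injective. -/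
open scoped TensorProduct

/-- The monodromy group `Γ_Δ` of a subset `Δ` of a `ℤ`-module `V` with bilinear form `B`:
the subgroup of automorphisms of `V` generated by the symplectic transvections
`T_δ : x ↦ x - B(x,δ) • δ` for `δ ∈ Δ`. -/
def monodromyGroup {V : Type*} [AddCommGroup V] [Module ℤ V]
    (B : LinearMap.BilinForm ℤ V) (Δ : Set V) : Subgroup (V ≃ₗ[ℤ] V) :=
  Subgroup.closure {T : V ≃ₗ[ℤ] V | ∃ δ ∈ Δ, ∀ x, T x = x - B x δ • δ}

/-- A subset `Δ ⊆ V` is a (skew-symmetric) vanishing lattice if (1) `Δ` generates `V`,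
(2) `Δ` is a single orbit under its monodromy group `Γ_Δ`, and (3) there exist
`δ₁, δ₂ ∈ Δ` with `B(δ₁,δ₂) = 1`. -/
def IsVanishingLattice {V : Type*} [AddCommGroup V] [Module ℤ V]
    (B : LinearMap.BilinForm ℤ V) (Δ : Set V) : Prop :=
  Submodule.span ℤ Δ = ⊤ ∧
  (∀ g ∈ monodromyGroup B Δ, ∀ δ ∈ Δ, g δ ∈ Δ) ∧
  (∀ δ₁ ∈ Δ, ∀ δ₂ ∈ Δ, ∃ g ∈ monodromyGroup B Δ, g δ₁ = δ₂) ∧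
  (∃ δ₁ ∈ Δ, ∃ δ₂ ∈ Δ, B δ₁ δ₂ = 1)

/-- A property of pairs of integers invariant under both elementary shears depends only on the
gcd of the pair. -/
theorem iff_gcd_zero_of_shear {f : ℤ → ℤ → Prop}
    (h₁ : ∀ x y, f x y ↔ f (x + y) y) (h₂ : ∀ x y, f x y ↔ f x (y + x)) (x y : ℤ) :
    f x y ↔ f (Int.gcd x y) 0 := by
  have rot (x y : ℤ) : f x y ↔ f (-y) x := by
    have e₁ := h₁ (x - y) y
    have e₂ := h₂ (x - y) y
    have e₃ := h₁ (-y) x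
    ring_nf at e₁ e₂ e₃ ⊢
    tauto
  have shear (k : ℕ) (x y : ℤ) : f x y ↔ f (x + k * y) y := by
    induction k with
    | zero => simp
    | succ k ih => rw [ih, h₁]; push_cast; ring_nf
  have shear' (k x y : ℤ) : f x y ↔ f (x + k * y) y := by
    obtain ⟨n, rfl | rfl⟩ := k.eq_nat_or_neg
    · exact shear n x y
    · rw [shear n (x + -(n : ℤ) * y) y]; ring_nf
  induction hn : y.natAbs using Nat.strong_induction_on generalizing x y with
  | _ n ih =>
    by_cases hy : y = 0
    · subst hy
      obtain ⟨n, rfl | rfl⟩ := x.eq_nat_or_neg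
      · simp
      · rw [rot, rot]; simp
    · have hmod : x + -(x / y) * y = x % y := by rw [Int.emod_def]; ring
      have hlt : (x % y).natAbs < n := by
        have := Int.emod_nonneg x hy
        have := Int.emod_lt_abs x hy
        have := Int.natCast_natAbs y
        omega
      have hrec := ih _ hlt (-y) (x % y) rfl
      rw [Int.neg_gcd, Int.gcd_comm, Int.gcd_emod] at hrec
      rw [shear' (-(x / y)) x y, hmod, rot]
      exact hrec

/-- A set stable under the transvections in the elements of `D` and under their inverses. -/
structure TransvectionStable {M : Type*} [AddCommGroup M]
    (B : LinearMap.BilinForm ℤ M) (D S : Set M) : Prop where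
  sub_mem : ∀ x ∈ S, ∀ δ ∈ D, x - B x δ • δ ∈ S
  add_mem : ∀ x ∈ S, ∀ δ ∈ D, x + B x δ • δ ∈ S

/-- The vectors `p` orthogonal to the hyperbolic pair `a, b` with `a + p ∈ D`. -/
def hyperbolicLink {M : Type*} [AddCommGroup M]
    (B : LinearMap.BilinForm ℤ M) (D : Set M) (a b : M) : Set M :=
  {p | B a p = 0 ∧ B b p = 0 ∧ a + p ∈ D}

/-- The projection onto the orthogonal complement of a hyperbolic pair `a, b`. -/
def hyperbolicProj {M : Type*} [AddCommGroup M]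
    (B : LinearMap.BilinForm ℤ M) (a b : M) : M →ₗ[ℤ] M :=
  LinearMap.id - (B.flip b).smulRight a + (B.flip a).smulRight b

theorem hyperbolicProj_apply {M : Type*} [AddCommGroup M]
    (B : LinearMap.BilinForm ℤ M) (a b x : M) :
    hyperbolicProj B a b x = x - B x b • a + B x a • b := rfl

theorem smul_add_smul_add_mem_iff {M : Type*} [AddCommGroup M]
    {B : LinearMap.BilinForm ℤ M} (halt : B.IsAlt) {D : Set M} (hD : TransvectionStable B D D)
    {a b p : M} (ha : a ∈ D) (hb : b ∈ D) (hab : B a b = 1) (hap : B a p = 0) (hbp : B b p = 0)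
    (x y : ℤ) : x • a + y • b + p ∈ D ↔ (Int.gcd x y : ℤ) • a + p ∈ D := by
  have hba : B b a = -1 := by rw [← halt.neg_eq, hab]
  have hpa : B p a = 0 := by rw [← halt.neg_eq, hap, neg_zero]
  have hpb : B p b = 0 := by rw [← halt.neg_eq, hbp, neg_zero]
  have hBa (x y : ℤ) : B (x • a + y • b + p) a = -y := by simp [hba, hpa, halt.self_eq_zero]
  have hBb (x y : ℤ) : B (x • a + y • b + p) b = x := by simp [hab, hpb, halt.self_eq_zero]
  have key := iff_gcd_zero_of_shear (f := fun x y => x • a + y • b + p ∈ D)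
    (fun x y => ⟨fun h => ?_, fun h => ?_⟩) (fun x y => ⟨fun h => ?_, fun h => ?_⟩) x y
  · simpa using key
  · convert hD.sub_mem _ h a ha using 1
    rw [hBa]; module
  · convert hD.add_mem _ h a ha using 1
    rw [hBa]; module
  · convert hD.add_mem _ h b hb using 1
    rw [hBb]; module
  · convert hD.sub_mem _ h b hb using 1
    rw [hBb]; module

section hyperbolicPair

variable {M : Type*} [AddCommGroup M] {B : LinearMap.BilinForm ℤ M} {D : Set M}
  {a b : M}

theorem mem_hyperbolicLink_of_gcd_eq_one (halt : B.IsAlt) (hD : TransvectionStable B D D)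
    (ha : a ∈ D) (hb : b ∈ D) (hab : B a b = 1) {p : M} (hap : B a p = 0) (hbp : B b p = 0)
    {x y : ℤ} (hxy : Int.gcd x y = 1) (h : x • a + y • b + p ∈ D) :
    p ∈ hyperbolicLink B D a b := by
  rw [smul_add_smul_add_mem_iff halt hD ha hb hab hap hbp, hxy] at h
  exact ⟨hap, hbp, by simpa using h⟩

theorem add_two_smul_mem_hyperbolicLink (halt : B.IsAlt) (hD : TransvectionStable B D D)
    (ha : a ∈ D) (hb : b ∈ D) (hab : B a b = 1) {p q : M} (hp : p ∈ hyperbolicLink B D a b)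
    (hq : q ∈ hyperbolicLink B D a b) :
    q + (2 : ℤ) • p ∈ hyperbolicLink B D a b ∧ q - (2 : ℤ) • p ∈ hyperbolicLink B D a b := by
  obtain ⟨hap, hbp, hpD⟩ := hp
  obtain ⟨haq, hbq, hqD⟩ := hq
  have hba : B b a = -1 := by rw [← halt.neg_eq, hab]
  have hqa : B q a = 0 := by rw [← halt.neg_eq, haq, neg_zero]
  have aux (ε x : ℤ) (hx : Int.gcd ε x = 1) : ε • a + x • b + q ∈ D := by
    rw [smul_add_smul_add_mem_iff halt hD ha hb hab haq hbq, hx]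
    simpa using hqD
  constructor
  · refine mem_hyperbolicLink_of_gcd_eq_one halt hD ha hb hab (by simp [haq, hap])
      (by simp [hbq, hbp]) (x := 1) (y := B q p + 2) (by simp) ?_
    convert hD.sub_mem _ (aux (-1) (B q p + 2) (by simp)) _ hpD using 1
    simp only [map_add, LinearMap.add_apply, map_smul, LinearMap.smul_apply, halt.self_eq_zero,
      hba, hqa, hap, hbp, smul_eq_mul]
    module
  · refine mem_hyperbolicLink_of_gcd_eq_one halt hD ha hb hab (by simp [haq, hap])
      (by simp [hbq, hbp]) (x := -1) (y := B q p - 2) (by simp) ?_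
    convert hD.sub_mem _ (aux 1 (B q p - 2) (by simp)) _ hpD using 1
    simp only [map_add, LinearMap.add_apply, map_smul, LinearMap.smul_apply, halt.self_eq_zero,
      hba, hqa, hap, hbp, smul_eq_mul]
    module

theorem two_smul_mem_hyperbolicLink (halt : B.IsAlt) (hD : TransvectionStable B D D)
    (ha : a ∈ D) (hb : b ∈ D) (hab : B a b = 1) {z : M}
    (hz : z ∈ AddSubgroup.closure (hyperbolicLink B D a b)) :
    (2 : ℤ) • z ∈ hyperbolicLink B D a b := by
  have key : ∀ q ∈ hyperbolicLink B D a b,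
      q + (2 : ℤ) • z ∈ hyperbolicLink B D a b ∧ q - (2 : ℤ) • z ∈ hyperbolicLink B D a b := by
    induction hz using AddSubgroup.closure_induction with
    | mem p hp => exact fun q hq => add_two_smul_mem_hyperbolicLink halt hD ha hb hab hp hq
    | zero => simp
    | add x y _ _ hx hy =>
      refine fun q hq => ⟨?_, ?_⟩
      · convert (hx _ (hy q hq).1).1 using 1; module
      · convert (hx _ (hy q hq).2).2 using 1; module
    | neg x _ hx =>
      refine fun q hq => ⟨?_, ?_⟩
      · convert (hx q hq).2 using 1; module
      · convert (hx q hq).1 using 1; module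
  simpa using (key 0 ⟨by simp, by simp, by simpa using ha⟩).1

/-- Up to a nonzero multiple, every element of `D` projects into the group generated by the link
of the hyperbolic pair `a, b`. -/
theorem exists_smul_hyperbolicProj_mem_closure (halt : B.IsAlt) (hD : TransvectionStable B D D)
    (ha : a ∈ D) (hb : b ∈ D) (hab : B a b = 1)
    (hconn : ∀ S : Set M, a ∈ S → TransvectionStable B D S → D ⊆ S) {x : M}
    (hx : x ∈ Submodule.span ℤ D) :
    ∃ n : ℤ, n ≠ 0 ∧
      n • hyperbolicProj B a b x ∈ AddSubgroup.closure (hyperbolicLink B D a b) := by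
  set C := AddSubgroup.closure (hyperbolicLink B D a b)
  set π := hyperbolicProj B a b with hπ
  have hba : B b a = -1 := by rw [← halt.neg_eq, hab]
  have smul_mem (k : ℤ) {z : M} (hz : z ∈ C) : k • z ∈ C := by
    exact C.zsmul_mem hz k
  have comb {u v : M} (hu : ∃ n : ℤ, n ≠ 0 ∧ n • π u ∈ C) (hv : ∃ n : ℤ, n ≠ 0 ∧ n • π v ∈ C)
      (k : ℤ) : ∃ n : ℤ, n ≠ 0 ∧ n • π (u + k • v) ∈ C := by
    obtain ⟨n, hn, hu⟩ := hu
    obtain ⟨m, hm, hv⟩ := hv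
    refine ⟨n * m, mul_ne_zero hn hm, ?_⟩
    convert C.add_mem (smul_mem m hu) (smul_mem (k * n) hv) using 1
    rw [map_add, map_smul]; module
  have dich : ∀ δ ∈ D, (∃ n : ℤ, n ≠ 0 ∧ n • π δ ∈ C) ∨
      ∀ u, (∃ n : ℤ, n ≠ 0 ∧ n • π u ∈ C) → B u δ = 0 := by
    intro δ hδ
    have haπ : B a (π δ) = 0 := by
      simp [hπ, hyperbolicProj_apply, hab, halt.self_eq_zero, ← halt.neg_eq a δ]
    have hbπ : B b (π δ) = 0 := by
      simp [hπ, hyperbolicProj_apply, hba, halt.self_eq_zero, ← halt.neg_eq b δ]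
    have hδπ : π δ = δ - B δ b • a + B δ a • b := rfl
    by_cases h₁ : B δ b = 0
    · by_cases h₂ : B δ a = 0
      · have hδ' : π δ = δ := by simp [hδπ, h₁, h₂]
        by_cases h₃ : ∃ q ∈ hyperbolicLink B D a b, B q δ ≠ 0
        · obtain ⟨q, hq, hqδ⟩ := h₃
          refine .inl ⟨B q δ, hqδ, ?_⟩
          have haδ : B a δ = 0 := hδ' ▸ haπ
          have hbδ : B b δ = 0 := hδ' ▸ hbπ
          have hq' : q - B q δ • δ ∈ hyperbolicLink B D a b := by
            refine ⟨by simp [hq.1, haδ], by simp [hq.2.1, hbδ], ?_⟩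
            convert hD.sub_mem _ hq.2.2 δ hδ using 1
            rw [map_add, LinearMap.add_apply, haδ]; module
          convert C.sub_mem (AddSubgroup.subset_closure hq) (AddSubgroup.subset_closure hq')
            using 1
          rw [hδ']; module
        · push Not at h₃
          refine .inr fun u ⟨n, hn, hu⟩ => ?_
          have hz : ∀ z ∈ C, B z δ = 0 := by
            intro z hz
            induction hz using AddSubgroup.closure_induction with
            | mem p hp => exact h₃ p hp
            | zero => simp
            | add x y _ _ hx hy => simp [hx, hy]
            | neg x _ hx => simp [hx]
          have := hz _ hu
          have haδ : B a δ = 0 := hδ' ▸ haπ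
          have hbδ : B b δ = 0 := hδ' ▸ hbπ
          simpa [hπ, hyperbolicProj_apply, haδ, hbδ, hn] using this
      · refine .inl ⟨B δ a, h₂, AddSubgroup.subset_closure ?_⟩
        refine mem_hyperbolicLink_of_gcd_eq_one halt hD ha hb hab (by simp [haπ])
          (by simp [hbπ]) (x := 1) (y := - (B δ a) ^ 2) (by simp) ?_
        convert hD.sub_mem _ ha δ hδ using 1
        rw [hδπ, ← halt.neg_eq δ a, h₁]; module
    · refine .inl ⟨B δ b, h₁, AddSubgroup.subset_closure ?_⟩
      refine mem_hyperbolicLink_of_gcd_eq_one halt hD ha hb hab (by simp [haπ])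
        (by simp [hbπ]) (x := (B δ b) ^ 2) (y := 1 - B δ b * B δ a) ?_ ?_
      · rw [← Int.isCoprime_iff_gcd_eq_one]
        refine IsCoprime.pow_left ⟨B δ a, 1, by ring⟩
      · convert hD.sub_mem _ hb δ hδ using 1
        rw [hδπ, ← halt.neg_eq δ b]; module
  have hDS : D ⊆ {u | ∃ n : ℤ, n ≠ 0 ∧ n • π u ∈ C} := by
    refine hconn _ ⟨1, one_ne_zero, ?_⟩ ⟨fun u hu δ hδ => ?_, fun u hu δ hδ => ?_⟩
    · simp [hπ, hyperbolicProj_apply, hab, halt.self_eq_zero]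
    · rcases dich δ hδ with h | h
      · rw [sub_eq_add_neg, ← neg_smul]; exact comb hu h _
      · simpa [h u hu] using hu
    · rcases dich δ hδ with h | h
      · exact comb hu h _
      · simpa [h u hu] using hu
  induction hx using Submodule.span_induction with
  | mem x hx => exact hDS hx
  | zero => exact ⟨1, one_ne_zero, by simp⟩
  | add x y _ _ hx hy => simpa using comb hx hy 1
  | smul k x _ hx => simpa using comb (u := 0) ⟨1, one_ne_zero, by simp⟩ hx k

/-- Some nonzero multiple of any radical vector `r` translates `a` to another element of `D`. -/
theorem exists_add_smul_mem_of_radical (halt : B.IsAlt) (hD : TransvectionStable B D D)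
    (ha : a ∈ D) (hb : b ∈ D) (hab : B a b = 1)
    (hconn : ∀ S : Set M, a ∈ S → TransvectionStable B D S → D ⊆ S) {r : M}
    (hr : r ∈ Submodule.span ℤ D) (hrad : ∀ x, B r x = 0) :
    ∃ m : ℤ, m ≠ 0 ∧ a + m • r ∈ D := by
  obtain ⟨n, hn, h⟩ := exists_smul_hyperbolicProj_mem_closure halt hD ha hb hab hconn hr
  have := (two_smul_mem_hyperbolicLink halt hD ha hb hab h).2.2
  refine ⟨2 * n, by simpa using hn, ?_⟩
  simpa [hyperbolicProj_apply, hrad, mul_smul] using this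

end hyperbolicPair

section cocycle

variable {V : Type*} [AddCommGroup V] {B : LinearMap.BilinForm ℤ V} {G : Type*} [Group G]
  {ρ : G →* (V ≃ₗ[ℤ] V)} {φ : G → ℚ ⊗[ℤ] V}

/-- The `ℚ`-linear extension of the functional `x ↦ B x v`. -/
noncomputable def rationalPairing (B : LinearMap.BilinForm ℤ V) (v : V) : ℚ ⊗[ℤ] V →ₗ[ℚ] ℚ :=
  (TensorProduct.AlgebraTensorModule.rid ℤ ℚ ℚ).toLinearMap ∘ₗ (B.flip v).baseChange ℚ

@[simp]
theorem rationalPairing_tmul (v x : V) (q : ℚ) :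
    rationalPairing B v (q ⊗ₜ x) = B x v * q := by
  simp [rationalPairing]

theorem rationalPairing_add_smul_of_radical {r : V} (hr : ∀ x, B x r = 0) (v : V) (m : ℤ)
    (w : ℚ ⊗[ℤ] V) : rationalPairing B (v + m • r) w = rationalPairing B v w := by
  induction w with
  | zero => simp
  | tmul q x => simp [hr]
  | add x y hx hy => simp [hx, hy]

theorem baseChange_transvection_apply {T : V ≃ₗ[ℤ] V} {u : V} (hT : ∀ v, T v = v - B v u • u)
    (w : ℚ ⊗[ℤ] V) :
    LinearMap.baseChange ℚ T.toLinearMap w = w - rationalPairing B u w ⊗ₜ u := by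
  induction w with
  | zero => simp
  | tmul q x =>
    simp only [LinearMap.baseChange_tmul, LinearEquiv.coe_coe, hT, TensorProduct.tmul_sub,
      rationalPairing_tmul, ← TensorProduct.smul_tmul]
    simp
  | add x y hx hy => rw [map_add, hx, hy, map_add, TensorProduct.add_tmul]; abel

/-- The pairs `(v, c)` with `v ∈ Δ` such that some group element acting as the transvection `T_v`
has cocycle value `-(c ⊗ v)`. -/
def cocycleLift (B : LinearMap.BilinForm ℤ V) (ρ : G →* (V ≃ₗ[ℤ] V)) (φ : G → ℚ ⊗[ℤ] V)
    (Δ : Set V) : Set (V × ℚ) :=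
  {p | p.1 ∈ Δ ∧ ∃ x : G, (∀ v, ρ x v = v - B v p.1 • p.1) ∧ φ x = -(p.2 ⊗ₜ p.1)}

/-- The pullback of a form on `V` along the projection `V × ℚ → V`. -/
def pullbackFst (B : LinearMap.BilinForm ℤ V) : LinearMap.BilinForm ℤ (V × ℚ) :=
  B.compl₁₂ (AddMonoidHom.fst V ℚ).toIntLinearMap (AddMonoidHom.fst V ℚ).toIntLinearMap

@[simp]
theorem pullbackFst_apply (p q : V × ℚ) : pullbackFst B p q = B p.1 q.1 := rfl

theorem baseChange_mul_apply (x y : G) (w : ℚ ⊗[ℤ] V) :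
    LinearMap.baseChange ℚ (ρ (x * y)).toLinearMap w =
      LinearMap.baseChange ℚ (ρ x).toLinearMap (LinearMap.baseChange ℚ (ρ y).toLinearMap w) := by
  induction w with
  | zero => simp
  | tmul q x => simp
  | add x y hx hy => simp only [map_add, hx, hy]

theorem baseChange_one_apply (w : ℚ ⊗[ℤ] V) :
    LinearMap.baseChange ℚ (ρ 1).toLinearMap w = w := by
  have : (ρ 1).toLinearMap = LinearMap.id := by ext; simp
  rw [this, LinearMap.baseChange_id, LinearMap.id_apply]

theorem cocycle_one
    (hφ : ∀ x y : G, φ (x * y) = LinearMap.baseChange ℚ (ρ x).toLinearMap (φ y) + φ x) :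
    φ 1 = 0 := by
  have h := hφ 1 1
  rw [mul_one, baseChange_one_apply] at h
  simpa using h

theorem apply_apply_of_acts_as_transvection (halt : B.IsAlt) {T : V ≃ₗ[ℤ] V} {u : V}
    (hT : ∀ v, T v = v - B v u • u) (x y : V) : B (T x) (T y) = B x y := by
  simp only [hT, map_sub, map_zsmul, LinearMap.sub_apply, LinearMap.smul_apply,
    halt.self_eq_zero, ← halt.neg_eq u y, smul_eq_mul]
  ring

/-- Elements of a group generated by isometries are isometries. -/
theorem apply_apply_of_mem_closure {s : Set G} (hs : ∀ h ∈ s, ∀ x y, B (ρ h x) (ρ h y) = B x y)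
    {h : G} (hh : h ∈ Subgroup.closure s) (x y : V) : B (ρ h x) (ρ h y) = B x y := by
  induction hh using Subgroup.closure_induction generalizing x y with
  | mem h hh => exact hs h hh x y
  | one => simp
  | mul a b _ _ ha hb => rw [map_mul, LinearEquiv.mul_apply, LinearEquiv.mul_apply, ha, hb]
  | inv a _ ha =>
    rw [← ha, ← LinearEquiv.mul_apply, ← LinearEquiv.mul_apply, ← map_mul, mul_inv_cancel,
      map_one, LinearEquiv.coe_one, id, id]

theorem conj_acts_as_transvection (hB : ∀ (h : G) (x y : V), B (ρ h x) (ρ h y) = B x y)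
    {y : G} {v : V} (hy : ∀ x, ρ y x = x - B x v • v) (h : G) (x : V) :
    ρ (h * y * h⁻¹) x = x - B x (ρ h v) • ρ h v := by
  have hx : ρ h (ρ h⁻¹ x) = x := by
    rw [← LinearEquiv.mul_apply, ← map_mul, mul_inv_cancel, map_one, LinearEquiv.coe_one, id]
  rw [map_mul, map_mul, LinearEquiv.mul_apply, LinearEquiv.mul_apply, hy, map_sub, map_zsmul, hx,
    ← hB h, hx]

theorem mem_cocycleLift_conj
    (hφ : ∀ x y : G, φ (x * y) = LinearMap.baseChange ℚ (ρ x).toLinearMap (φ y) + φ x)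
    (hB : ∀ (h : G) (x y : V), B (ρ h x) (ρ h y) = B x y) {Δ : Set V}
    (hΔ : ∀ (h : G), ∀ v ∈ Δ, ρ h v ∈ Δ) {p : V × ℚ} (hp : p ∈ cocycleLift B ρ φ Δ)
    {h : G} {k : ℚ} {u : V} (hh : φ h = k ⊗ₜ u) :
    (ρ h p.1, p.2 - B u (ρ h p.1) * k) ∈ cocycleLift B ρ φ Δ := by
  obtain ⟨hpΔ, y, hy, hφy⟩ := hp
  have hz := conj_acts_as_transvection hB hy h
  refine ⟨hΔ h _ hpΔ, h * y * h⁻¹, hz, ?_⟩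
  have e := hφ (h * y * h⁻¹) h
  rw [inv_mul_cancel_right, hφ h y, hφy, hh, baseChange_transvection_apply hz] at e
  simp only [map_neg, LinearMap.baseChange_tmul, LinearEquiv.coe_coe, rationalPairing_tmul] at e
  rw [TensorProduct.sub_tmul]
  linear_combination (norm := module) (-1 : ℚ) • e

theorem cocycle_inv_of_transvection (halt : B.IsAlt)
    (hφ : ∀ x y : G, φ (x * y) = LinearMap.baseChange ℚ (ρ x).toLinearMap (φ y) + φ x)
    {x : G} {u : V} {d : ℚ} (hx : ∀ v, ρ x v = v - B v u • u) (hφx : φ x = -(d ⊗ₜ u)) :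
    φ x⁻¹ = d ⊗ₜ u := by
  have hu : ρ x⁻¹ u = u := by
    have h : ρ x u = u := by simp [hx, halt.self_eq_zero]
    conv_lhs => rw [← h]
    rw [← LinearEquiv.mul_apply, ← map_mul, inv_mul_cancel, map_one, LinearEquiv.coe_one, id]
  have e := hφ x⁻¹ x
  rw [inv_mul_cancel, cocycle_one hφ, hφx, map_neg, LinearMap.baseChange_tmul,
    LinearEquiv.coe_coe, hu] at e
  linear_combination (norm := module) (-1 : ℚ) • e

theorem transvectionStable_cocycleLift (halt : B.IsAlt)
    (hφ : ∀ x y : G, φ (x * y) = LinearMap.baseChange ℚ (ρ x).toLinearMap (φ y) + φ x)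
    (hB : ∀ (h : G) (x y : V), B (ρ h x) (ρ h y) = B x y) {Δ : Set V}
    (hΔ : ∀ (h : G), ∀ v ∈ Δ, ρ h v ∈ Δ) :
    TransvectionStable (pullbackFst B) (cocycleLift B ρ φ Δ) (cocycleLift B ρ φ Δ) := by
  constructor
  · rintro p hp ⟨u, d⟩ ⟨-, x, hx, hφx⟩
    dsimp only at hx hφx
    convert mem_cocycleLift_conj hφ hB hΔ hp (h := x) (k := -d) (u := u)
      (by rw [hφx, TensorProduct.neg_tmul]) using 1
    ext
    · simp [hx]
    · simp [hx, halt.self_eq_zero, ← halt.neg_eq u p.1]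
  · rintro p hp ⟨u, d⟩ ⟨-, x, hx, hφx⟩
    dsimp only at hx hφx
    have hinv : ρ x⁻¹ p.1 = p.1 + B p.1 u • u := by
      have : p.1 = ρ x (p.1 + B p.1 u • u) := by simp [hx, halt.self_eq_zero]
      conv_lhs => rw [this]
      rw [← LinearEquiv.mul_apply, ← map_mul, inv_mul_cancel, map_one, LinearEquiv.coe_one, id]
    convert mem_cocycleLift_conj hφ hB hΔ hp (h := x⁻¹)
      (cocycle_inv_of_transvection halt hφ hx hφx) using 1
    ext
    · simp [-map_inv, hinv]
    · simp [-map_inv, hinv, halt.self_eq_zero, ← halt.neg_eq u p.1, sub_eq_add_neg]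

/-- Group elements acting as `T_u` and `T_{u + m r}`, with `r` in the radical, have proportional
cocycle values if the cocycle is pointwise a coboundary. -/
theorem eq_of_mem_cocycleLift_add_smul_radical
    (hφ : ∀ x y : G, φ (x * y) = LinearMap.baseChange ℚ (ρ x).toLinearMap (φ y) + φ x)
    (hker : ∀ x : G, ∃ w : ℚ ⊗[ℤ] V, φ x = LinearMap.baseChange ℚ (ρ x).toLinearMap w - w)
    {Δ : Set V} {u r t : V} {c c' : ℚ} {m : ℤ} (hr : ∀ x, B x r = 0) (hr' : ∀ x, B r x = 0)
    (ht : B u t ≠ 0) (h : (u, c) ∈ cocycleLift B ρ φ Δ)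
    (h' : (u + m • r, c') ∈ cocycleLift B ρ φ Δ) : c = c' := by
  obtain ⟨-, x, hx, hφx⟩ := h
  obtain ⟨-, y, hy, hφy⟩ := h'
  dsimp only at hx hφx hy hφy
  obtain ⟨w, hw⟩ := hker (x⁻¹ * y)
  have e := hφ x (x⁻¹ * y)
  rw [hw, map_sub, ← baseChange_mul_apply, mul_inv_cancel_left, hφx, hφy,
    baseChange_transvection_apply hx, baseChange_transvection_apply hy,
    rationalPairing_add_smul_of_radical hr] at e
  have e' := congrArg (rationalPairing B t) e
  simp only [map_add, map_sub, map_neg, rationalPairing_tmul, LinearMap.add_apply, map_zsmul,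
    LinearMap.smul_apply, hr', smul_zero, add_zero] at e'
  have ht' : (B u t : ℚ) ≠ 0 := by exact_mod_cast ht
  apply mul_left_cancel₀ ht'
  linear_combination e'

theorem exists_mem_cocycleLift
    (hker : ∀ x : G, ∃ w : ℚ ⊗[ℤ] V, φ x = LinearMap.baseChange ℚ (ρ x).toLinearMap w - w)
    {Δ : Set V} {v : V} (hv : v ∈ Δ) {x : G} (hx : ∀ y, ρ x y = y - B y v • v) :
    ∃ c : ℚ, (v, c) ∈ cocycleLift B ρ φ Δ ∧ φ x = -(c ⊗ₜ v) := by
  obtain ⟨w, hw⟩ := hker x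
  have h : φ x = -(rationalPairing B v w ⊗ₜ v) := by
    rw [hw, baseChange_transvection_apply hx]; abel
  exact ⟨_, ⟨hv, x, hx, h⟩, h⟩

/-- The lift of an orbit is connected under transvections. -/
theorem cocycleLift_subset_of_transvectionStable (halt : B.IsAlt)
    (hφ : ∀ x y : G, φ (x * y) = LinearMap.baseChange ℚ (ρ x).toLinearMap (φ y) + φ x)
    (hker : ∀ x : G, ∃ w : ℚ ⊗[ℤ] V, φ x = LinearMap.baseChange ℚ (ρ x).toLinearMap w - w)
    (hB : ∀ (h : G) (x y : V), B (ρ h x) (ρ h y) = B x y) {Δ : Set V}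
    (hΔ : ∀ (h : G), ∀ v ∈ Δ, ρ h v ∈ Δ)
    (hlift : ∀ v ∈ Δ, ∃ c : ℚ, (v, c) ∈ cocycleLift B ρ φ Δ)
    (htrans : ∀ v ∈ Δ, ∀ w ∈ Δ, ∃ γ ∈ monodromyGroup B Δ, γ v = w)
    (hpair : ∀ v ∈ Δ, ∃ t, B v t ≠ 0)
    {a : V × ℚ} (ha : a ∈ cocycleLift B ρ φ Δ) {S : Set (V × ℚ)} (haS : a ∈ S)
    (hS : TransvectionStable (pullbackFst B) (cocycleLift B ρ φ Δ) S) :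
    cocycleLift B ρ φ Δ ⊆ S := by
  have hD := transvectionStable_cocycleLift halt hφ hB hΔ
  have reach : ∀ γ ∈ monodromyGroup B Δ,
      (∀ s ∈ S ∩ cocycleLift B ρ φ Δ, ∃ s' ∈ S ∩ cocycleLift B ρ φ Δ, s'.1 = γ s.1) ∧
      (∀ s ∈ S ∩ cocycleLift B ρ φ Δ, ∃ s' ∈ S ∩ cocycleLift B ρ φ Δ, s'.1 = γ⁻¹ s.1) := by
    intro γ hγ
    induction hγ using Subgroup.closure_induction with
    | mem T hT =>
      obtain ⟨δ, hδ, hT⟩ := hT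
      obtain ⟨c, hc⟩ := hlift δ hδ
      refine ⟨fun s hs => ⟨_, ⟨hS.sub_mem s hs.1 _ hc, hD.sub_mem s hs.2 _ hc⟩, by simp [hT]⟩,
        fun s hs => ⟨_, ⟨hS.add_mem s hs.1 _ hc, hD.add_mem s hs.2 _ hc⟩, ?_⟩⟩
      apply T.injective
      rw [← LinearEquiv.mul_apply T T⁻¹, mul_inv_cancel, LinearEquiv.coe_one, id, hT]
      simp [halt.self_eq_zero]
    | one => exact ⟨fun s hs => ⟨s, hs, by simp⟩, fun s hs => ⟨s, hs, by simp⟩⟩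
    | mul x y _ _ hx hy =>
      refine ⟨fun s hs => ?_, fun s hs => ?_⟩
      · obtain ⟨s₁, hs₁, e₁⟩ := hy.1 s hs
        obtain ⟨s₂, hs₂, e₂⟩ := hx.1 s₁ hs₁
        exact ⟨s₂, hs₂, by rw [e₂, e₁, LinearEquiv.mul_apply]⟩
      · obtain ⟨s₁, hs₁, e₁⟩ := hx.2 s hs
        obtain ⟨s₂, hs₂, e₂⟩ := hy.2 s₁ hs₁
        exact ⟨s₂, hs₂, by rw [e₂, e₁, mul_inv_rev, LinearEquiv.mul_apply]⟩
    | inv x _ hx => exact ⟨hx.2, by simpa using hx.1⟩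
  rintro ⟨v, c⟩ hv
  obtain ⟨γ, hγ, hγv⟩ := htrans a.1 ha.1 v hv.1
  obtain ⟨⟨v', c'⟩, hs, e⟩ := (reach γ hγ).1 a ⟨haS, ha⟩
  obtain ⟨t, ht⟩ := hpair v hv.1
  obtain rfl : v' = v := e.trans hγv
  obtain rfl : c = c' := eq_of_mem_cocycleLift_add_smul_radical (r := 0) (m := 0) hφ hker
    (by simp) (by simp) ht hv (by simpa using hs.2)
  exact hs.1

end cocycle

/-- A finite system of rational linear equations is solvable if every integral linear relation
between the functionals is satisfied by the right-hand sides. -/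
theorem exists_forall_apply_eq_of_integral_relations {W ι : Type*} [AddCommGroup W] [Module ℚ W]
    [Fintype ι] (f : ι → W →ₗ[ℚ] ℚ) (c : ι → ℚ)
    (h : ∀ k : ι → ℤ, (∀ w, ∑ i, k i * f i w = 0) → ∑ i, (k i : ℚ) * c i = 0) :
    ∃ w, ∀ i, f i w = c i := by
  classical
  by_contra hne
  have hc : c ∉ LinearMap.range (LinearMap.pi f) := by
    rintro ⟨w, hw⟩
    exact hne ⟨w, fun i => congrFun hw i⟩
  obtain ⟨ψ, hψc, hψ⟩ := Submodule.exists_le_ker_of_notMem hc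
  obtain ⟨⟨b, hb⟩, hk⟩ := IsLocalization.exist_integer_multiples_of_finite (nonZeroDivisors ℤ)
    fun i => ψ (Pi.single i 1)
  choose k hk using hk
  have hb0 : (b : ℚ) ≠ 0 := by exact_mod_cast nonZeroDivisors.ne_zero hb
  have hk' (i : ι) : (k i : ℚ) = b * ψ (Pi.single i 1) := by simpa using hk i
  have hψs (x : ι → ℚ) : ∑ i, (k i : ℚ) * x i = b * ψ x := by
    conv_rhs => rw [LinearMap.pi_apply_eq_sum_univ ψ x, Finset.mul_sum]
    refine Finset.sum_congr rfl fun i _ => ?_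
    rw [hk', smul_eq_mul]
    have : (fun j => if i = j then (1 : ℚ) else 0) = Pi.single i 1 := by
      ext j; simp [Pi.single_apply, eq_comm]
    rw [this]; ring
  have := h k fun w => by
    rw [hψs fun i => f i w]
    have : ψ (LinearMap.pi f w) = 0 := hψ ⟨w, rfl⟩
    exact mul_eq_zero_of_right _ this
  rw [hψs] at this
  exact hψc ((mul_eq_zero.mp this).resolve_left hb0)

/-- Let `V` be a free `ℤ`-module of finite rank with an alternating
bilinear form `B`, and let `G` be a group generated by `g₁, …, gₙ` acting on `V` with
distinguished elements `e₁, …, eₙ` so that `gᵢ` acts as the transvection `T_{eᵢ}`.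
Assume `Δ = G · {e₁, …, eₙ}` is a skew-symmetric vanishing lattice in `V`, and let
`V_ℚ = ℚ ⊗ V` carry the induced `G`-action.  Then every 1-cocycle `φ : G → V_ℚ` with
`φ(g) ∈ (g - id) V_ℚ` for every `g ∈ G` is a 1-coboundary; equivalently, the restriction
map `H¹(G, V_ℚ) → ∏_{g ∈ G} V_ℚ/(g - id)V_ℚ` is injective. -/
theorem stmt4 {V : Type*} [AddCommGroup V] [Module ℤ V] [Module.Free ℤ V] [Module.Finite ℤ V]
    (B : LinearMap.BilinForm ℤ V) (halt : ∀ x : V, B x x = 0)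
    (G : Type*) [Group G] (ρ : G →* (V ≃ₗ[ℤ] V))
    (n : ℕ) (g : Fin n → G) (e : Fin n → V)
    (hgen : Subgroup.closure (Set.range g) = ⊤)
    (hact : ∀ (i : Fin n) (v : V), ρ (g i) v = v - B v (e i) • e i)
    (hVL : IsVanishingLattice B {v : V | ∃ (h : G) (i : Fin n), ρ h (e i) = v})
    (φ : G → ℚ ⊗[ℤ] V)
    (hcocycle : ∀ x y : G,
      φ (x * y) = LinearMap.baseChange ℚ (ρ x).toLinearMap (φ y) + φ x)
    (hker : ∀ x : G, ∃ w : ℚ ⊗[ℤ] V,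
      φ x = LinearMap.baseChange ℚ (ρ x).toLinearMap w - w) :
    ∃ w : ℚ ⊗[ℤ] V, ∀ x : G,
      φ x = LinearMap.baseChange ℚ (ρ x).toLinearMap w - w := by
  obtain rfl : ‹Module ℤ V› = AddCommGroup.toIntModule V := Subsingleton.elim _ _
  have hB : B.IsAlt := halt
  set Δ : Set V := {v : V | ∃ (h : G) (i : Fin n), ρ h (e i) = v}
  obtain ⟨-, -, htrans, δ₁, hδ₁, δ₂, hδ₂, h₁₂⟩ := hVL
  have hiso (h : G) : ∀ x y : V, B (ρ h x) (ρ h y) = B x y := by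
    refine apply_apply_of_mem_closure ?_ (hgen ▸ Subgroup.mem_top h)
    rintro _ ⟨i, rfl⟩
    exact apply_apply_of_acts_as_transvection hB (hact i)
  have hΔ : ∀ h : G, ∀ v ∈ Δ, ρ h v ∈ Δ := by
    rintro h _ ⟨k, i, rfl⟩
    exact ⟨h * k, i, by simp⟩
  have heΔ (i : Fin n) : e i ∈ Δ := ⟨1, i, by simp⟩
  have hlift : ∀ v ∈ Δ, ∃ c : ℚ, (v, c) ∈ cocycleLift B ρ φ Δ := by
    intro v hv
    obtain ⟨h, i, rfl⟩ := id hv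
    obtain ⟨c, hc, -⟩ := exists_mem_cocycleLift hker hv
      (conj_acts_as_transvection hiso (hact i) h)
    exact ⟨c, hc⟩
  have hmono : ∀ γ ∈ monodromyGroup B Δ, ∀ x y : V, B (γ x) (γ y) = B x y := by
    refine fun γ hγ => apply_apply_of_mem_closure (ρ := MonoidHom.id _) ?_ hγ
    rintro T ⟨δ, -, hT⟩
    exact apply_apply_of_acts_as_transvection hB hT
  have hpair : ∀ v ∈ Δ, ∃ t, B v t ≠ 0 := by
    intro v hv
    obtain ⟨γ, hγ, rfl⟩ := htrans δ₁ hδ₁ v hv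
    exact ⟨γ δ₂, by rw [hmono γ hγ, h₁₂]; exact one_ne_zero⟩
  choose c hc hφc using fun i => exists_mem_cocycleLift hker (heΔ i) (hact i)
  obtain ⟨w, hw⟩ := exists_forall_apply_eq_of_integral_relations
      (fun i => rationalPairing B (e i)) c fun k hk => by
    obtain ⟨d₁, hd₁⟩ := hlift δ₁ hδ₁
    obtain ⟨d₂, hd₂⟩ := hlift δ₂ hδ₂
    have hrad (x : V) : B x (∑ i, k i • e i) = 0 := by
      have := hk (1 ⊗ₜ x)
      simp only [rationalPairing_tmul, mul_one] at this
      simpa using (by exact_mod_cast this : ∑ i, k i * B x (e i) = 0)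
    have hrad' (x : V) : B (∑ i, k i • e i) x = 0 := by rw [← hB.neg_eq, hrad, neg_zero]
    obtain ⟨m, hm, hmem⟩ := exists_add_smul_mem_of_radical (B := pullbackFst B)
      (fun p => hB.self_eq_zero p.1) (transvectionStable_cocycleLift hB hcocycle hiso hΔ) hd₁ hd₂
      h₁₂ (fun S haS hS => cocycleLift_subset_of_transvectionStable hB hcocycle hker hiso hΔ hlift
        htrans hpair hd₁ haS hS) (r := ∑ i, k i • (e i, c i))
      (Submodule.sum_mem _ fun i _ => Submodule.smul_mem _ _ (Submodule.subset_span (hc i)))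
      (fun x => by simpa [Prod.fst_sum] using hrad' x.1)
    have hsum : (δ₁, d₁) + m • ∑ i, k i • (e i, c i) =
        (δ₁ + m • ∑ i, k i • e i, d₁ + m * ∑ i, (k i : ℚ) * c i) := by
      ext <;> simp [Prod.fst_sum, Prod.snd_sum]
    rw [hsum] at hmem
    have := eq_of_mem_cocycleLift_add_smul_radical hcocycle hker hrad hrad'
      (by rw [h₁₂]; exact one_ne_zero) hd₁ hmem
    have hm' : (m : ℚ) ≠ 0 := by exact_mod_cast hm
    simpa [hm'] using this
  refine ⟨w, fun x => ?_⟩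
  have hx : x ∈ Subgroup.closure (Set.range g) := hgen ▸ Subgroup.mem_top x
  induction hx using Subgroup.closure_induction with
  | mem x hx =>
    obtain ⟨i, rfl⟩ := hx
    rw [hφc, baseChange_transvection_apply (hact i), hw]; abel
  | one => rw [cocycle_one hcocycle, baseChange_one_apply, sub_self]
  | mul x y _ _ hx hy =>
    rw [hcocycle, hx, hy, baseChange_mul_apply, map_sub]; abel
  | inv x _ hx =>
    have e := hcocycle x⁻¹ x
    rw [hx, map_sub, ← baseChange_mul_apply, inv_mul_cancel, cocycle_one hcocycle,
      baseChange_one_apply] at e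
    linear_combination (norm := module) (-1 : ℚ) • e
end

section
/- Let V be a free ℤ-module of finite rank with a nondegenerate alternating bilinear form B, let Δ ⊆ V be a skew-symmetric vanishing lattice, and let Γ = Γ_Δ be its monodromy group, acting on V_ℚ = V ⊗ ℚ. If φ : Γ → V_ℚ is a 1-cocycle such that φ(T_δ) ∈ ℚ·δ for every δ ∈ Δ, then φ is a 1-coboundary. -/
open scoped TensorProduct

/-- A rational function `c` is compatible with `Δ` if `Δ` is stable under all powers of the
transvections in its elements, and `c` transforms under them like a linear form does. -/
def TransvectionCompatible {V : Type*} [AddCommGroup V]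
    (B : LinearMap.BilinForm ℤ V) (Δ : Set V) (c : V → ℚ) : Prop :=
  ∀ ε ∈ Δ, ∀ δ ∈ Δ, ∀ n k : ℤ, ∀ x : V, k = n * B δ ε → x = δ - k • ε →
    x ∈ Δ ∧ c x = c δ - k * c ε

section TransvectionCompatible

variable {V : Type*} [AddCommGroup V] {B : LinearMap.BilinForm ℤ V} {Δ : Set V}
  {c : V → ℚ}

lemma TransvectionCompatible.sub_linear (hc : TransvectionCompatible B Δ c) (L : V →ₗ[ℤ] ℚ) :
    TransvectionCompatible B Δ (fun x ↦ c x - L x) := by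
  intro ε hε δ hδ n k x hk hx
  obtain ⟨h1, h2⟩ := hc ε hε δ hδ n k x hk hx
  refine ⟨h1, ?_⟩
  have : L x = L δ - k * L ε := by
    rw [hx, map_sub, map_smul, zsmul_eq_mul]
  simp only [h2, this]
  ring

/-- The Euclidean algorithm, run by means of the transvections in a hyperbolic pair. -/
lemma TransvectionCompatible.exists_orthogonal_left (hc : TransvectionCompatible B Δ c)
    (halt : ∀ x, B x x = 0) {a b : V} (ha : a ∈ Δ) (hb : b ∈ Δ) (hab : B a b = 1)
    (hca : c a = 0) (hcb : c b = 0) (n : ℕ) :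
    ∀ δ ∈ Δ, (B δ a).natAbs ≤ n → (B δ a ≠ 0 ∨ B δ b ≠ 0) →
      ∃ δ' ∈ Δ, c δ' = c δ ∧ B δ' a = 0 ∧ B δ' b ≠ 0 := by
  have hba : B b a = -1 := by rw [← hab, LinearMap.IsAlt.neg halt]
  induction n with
  | zero =>
    intro δ hδ h0 h
    have h0 : B δ a = 0 := by omega
    exact ⟨δ, hδ, rfl, h0, by tauto⟩
  | succ n ih =>
    intro δ hδ hn h
    by_cases h0 : B δ a = 0
    · exact ⟨δ, hδ, rfl, h0, by tauto⟩
    set p := B δ a with hp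
    set r := B δ b with hr
    obtain ⟨h1, h1c⟩ := hc a ha δ hδ (r / p - 1) ((r / p - 1) * p) _ (by rw [← hp]) rfl
    have hdm := Int.emod_add_mul_ediv r p
    set x := δ - ((r / p - 1) * p) • a with hx
    have hxa : B x a = p := by simp [hx, halt, ← hp]
    have hxb : B x b = r % p + p := by
      simp [hx, hab, ← hr]
      linarith
    obtain ⟨h2, h2c⟩ := hc b hb x h1 (-1) (-(r % p + p)) _ (by rw [hxb]; ring) rfl
    set y := x - (-(r % p + p)) • b with hy
    have hya : B y a = -(r % p) := by
      simp only [hy, map_sub, LinearMap.sub_apply, map_smul, LinearMap.smul_apply, hxa, hba,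
        smul_eq_mul]
      ring
    have hyb : B y b = r % p + p := by simp [hy, hxb, halt]
    obtain ⟨h3, h3c⟩ := hc a ha y h2 (-1) (r % p) _ (by rw [hya]; ring) rfl
    set z := y - (r % p) • a with hz
    have hza : B z a = -(r % p) := by simp [hz, halt, hya]
    have hzb : B z b = p := by simp [hz, hab, hyb]
    obtain ⟨δ', h4, h4c, h5⟩ := ih z h3 (by
      rw [hza]
      have := Int.emod_nonneg r h0
      have := Int.emod_lt_abs r h0
      rw [Int.abs_eq_natAbs] at this
      omega) (Or.inr (by rwa [hzb]))
    refine ⟨δ', h4, ?_, h5⟩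
    rw [h4c, h3c, h2c, h1c, hca, hcb]
    ring

lemma TransvectionCompatible.eq_zero_of_not_orthogonal (hc : TransvectionCompatible B Δ c)
    (halt : ∀ x, B x x = 0) {a b : V} (ha : a ∈ Δ) (hb : b ∈ Δ) (hab : B a b = 1)
    (hca : c a = 0) (hcb : c b = 0) (hD : ∀ x ∈ Δ, B x a = 0 → B x b = 1 → c x = 0)
    {δ : V} (hδ : δ ∈ Δ) (h : B δ a ≠ 0 ∨ B δ b ≠ 0) : c δ = 0 := by
  have hba : B b a = -1 := by rw [← hab, LinearMap.IsAlt.neg halt]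
  obtain ⟨d, hd, hdc, hda, hdb⟩ :=
    hc.exists_orthogonal_left halt ha hb hab hca hcb _ δ hδ le_rfl h
  rw [← hdc]
  set m := B d b with hm
  have hbd : B b d = -m := by rw [hm, LinearMap.IsAlt.neg halt]
  obtain ⟨h1, h1c⟩ := hc d hd b hb 1 (-m) _ (by rw [hbd]; ring) rfl
  set y := b - (-m) • d with hy
  have hya : B y a = -1 := by simp [hy, hda, hba]
  have hyb : B y b = m * m := by simp [hy, halt, ← hm]
  obtain ⟨h2, h2c⟩ := hc a ha y h1 (1 - m * m) (m * m - 1) _ (by rw [hya]; ring) rfl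
  set z := y - (m * m - 1) • a with hz
  have hza : B z a = -1 := by simp [hz, halt, hya]
  have hzb : B z b = 1 := by simp [hz, hab, hyb]
  obtain ⟨h3, h3c⟩ := hc b hb z h2 1 1 _ (by rw [hzb]; ring) rfl
  have h4 := hD _ h3 (by simp [hza, hba]) (by simp [hzb, halt])
  rw [h3c, h2c, h1c, hca, hcb] at h4
  have hm0 : (m : ℚ) ≠ 0 := by exact_mod_cast hdb
  have : (m : ℚ) * c d = 0 := by push_cast at h4; linarith
  exact (mul_eq_zero.mp this).resolve_left hm0

lemma TransvectionCompatible.eq_zero (hc : TransvectionCompatible B Δ c)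
    (halt : ∀ x, B x x = 0)
    (hconn : ∀ G ⊆ Δ, G.Nonempty →
      (∀ η ∈ G, ∀ ε ∈ Δ, ∀ n : ℤ, η - (n * B η ε) • ε ∈ G) → Δ ⊆ G)
    {a b : V} (ha : a ∈ Δ) (hb : b ∈ Δ) (hab : B a b = 1)
    (hca : c a = 0) (hcb : c b = 0) (hD : ∀ x ∈ Δ, B x a = 0 → B x b = 1 → c x = 0)
    {δ : V} (hδ : δ ∈ Δ) : c δ = 0 := by
  set P : V → Prop := fun x ↦ B x a ≠ 0 ∨ B x b ≠ 0 with hP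
  have hP0 : ∀ x ∈ Δ, P x → c x = 0 := fun x hx h ↦
    hc.eq_zero_of_not_orthogonal halt ha hb hab hca hcb hD hx h
  have hPadd : ∀ x y : V, ∀ k : ℤ, P x → ¬ P y → P (x - k • y) := by
    intro x y k hx hy
    simp only [hP, not_or, not_not] at hx hy ⊢
    simpa [hy.1, hy.2] using hx
  have hswap : ∀ x y : V, B x y ≠ 0 → B y x ≠ 0 := by
    intro x y h h'
    rw [← LinearMap.IsAlt.neg halt, h', neg_zero] at h
    exact h rfl
  set G : Set V := {x | x ∈ Δ ∧ (P x ∨ ∃ ε ∈ Δ, P ε ∧ B x ε ≠ 0)} with hG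
  have key : ∀ η ∈ G, ∀ ε ∈ Δ, B η ε ≠ 0 → ε ∈ G := by
    rintro η ⟨hη, hη'⟩ ε hε hne
    refine ⟨hε, ?_⟩
    by_cases hPη : P η
    · exact Or.inr ⟨η, hη, hPη, hswap _ _ hne⟩
    obtain ⟨ε₀, hε₀, hPε₀, hB⟩ := hη'.resolve_left hPη
    by_cases h0 : B ε ε₀ = 0
    · refine Or.inr ⟨ε₀ - (1 * B ε₀ η) • η, (hc η hη ε₀ hε₀ 1 _ _ rfl rfl).1,
        hPadd _ _ _ hPε₀ hPη, ?_⟩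
      simp [h0, hswap _ _ hB, hswap _ _ hne]
    · exact Or.inr ⟨ε₀, hε₀, hPε₀, h0⟩
  have hGc : ∀ x ∈ G, c x = 0 := by
    rintro x ⟨hx, hx'⟩
    by_cases hPx : P x
    · exact hP0 x hx hPx
    obtain ⟨ε, hε, hPε, hB⟩ := hx'.resolve_left hPx
    obtain ⟨h1, h2⟩ := hc x hx ε hε 1 _ _ rfl rfl
    rw [hP0 _ h1 (hPadd _ _ _ hPε hPx), hP0 _ hε hPε] at h2
    have h3 : ((1 * B ε x : ℤ) : ℚ) ≠ 0 := by
      rw [one_mul]; exact_mod_cast hswap _ _ hB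
    have : ((1 * B ε x : ℤ) : ℚ) * c x = 0 := by linarith
    exact (mul_eq_zero.mp this).resolve_left h3
  refine hGc δ (hconn G (fun x hx ↦ hx.1) ⟨a, ha, Or.inl (Or.inr (by rw [hab]; simp))⟩ ?_ hδ)
  intro η hη ε hε n
  by_cases h0 : B η ε = 0
  · simpa [h0] using hη
  · have hε' := key η hη ε hε h0
    refine key ε hε' _ (hc ε hε η hη.1 n _ _ rfl rfl).1 ?_
    simpa [halt] using hswap _ _ h0

/-- Elements `a + v` and `a + w` of `Δ` with `v` and `w` orthogonal to a hyperbolic pair `a`, `b`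
give rise to elements `a + v - 2 * n * w`. -/
lemma TransvectionCompatible.add_sub_two_mul (hc : TransvectionCompatible B Δ c)
    (halt : ∀ x, B x x = 0) {a b : V} (ha : a ∈ Δ) (hb : b ∈ Δ) (hab : B a b = 1)
    (hca : c a = 0) (hcb : c b = 0) {v w : V} (hvb : B v b = 0)
    (hwa : B w a = 0) (hwb : B w b = 0) (hv : a + v ∈ Δ) (hw : a + w ∈ Δ) (n : ℤ) :
    a + (v - (2 * n) • w) ∈ Δ ∧ c (a + (v - (2 * n) • w)) = c (a + v) - 2 * n * c (a + w) := by
  have hba : B b a = -1 := by rw [← hab, LinearMap.IsAlt.neg halt]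
  have haw : B a w = 0 := by rw [← LinearMap.IsAlt.neg halt, hwa, neg_zero]
  obtain ⟨h1, h1c⟩ := hc b hb _ hw (-1) (-1) (a + b + w) (by simp [hab, hwb]) (by module)
  obtain ⟨h2, h2c⟩ := hc a ha _ h1 (-1) 1 (b + w) (by simp [halt, hba, hwa]) (by module)
  obtain ⟨h3, h3c⟩ := hc b hb _ hw 1 1 (a - b + w) (by simp [hab, hwb]) (by module)
  obtain ⟨h4, h4c⟩ := hc a ha _ h3 1 1 (-b + w) (by simp [halt, hba, hwa]) (by module)
  rw [hca] at h2c h4c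
  rw [hcb] at h1c h3c
  set β := B v w with hβ
  obtain ⟨h5, h5c⟩ := hc _ h2 _ hv n (n * (1 + β)) _
    (by simp [hab, haw, hvb, ← hβ]) rfl
  obtain ⟨h6, h6c⟩ := hc b hb _ h5 (-(n * (1 + β))) (-(n * (1 + β)))
    (a + (v - (n * (1 + β)) • w)) (by simp [hab, hvb, halt, hwb]) (by module)
  obtain ⟨h7, h7c⟩ := hc _ h4 _ h6 (-n) (-n * (β - 1)) _
    (by simp [hab, haw, hvb, ← hβ, halt, hwb]; left; ring) rfl
  obtain ⟨h8, h8c⟩ := hc b hb _ h7 (n * (1 - β)) (n * (1 - β))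
    (a + (v - (2 * n) • w)) (by simp [hab, hvb, halt, hwb]) (by module)
  refine ⟨h8, ?_⟩
  rw [h8c, h7c, h6c, h5c, h4c, h3c, h2c, h1c, hcb]
  push_cast
  ring

/-- The values of `c` on `a + D`, where `D` is orthogonal to the hyperbolic pair `a`, `b`, extend
to a linear form. -/
lemma TransvectionCompatible.exists_linear_add (hc : TransvectionCompatible B Δ c)
    (halt : ∀ x, B x x = 0) {a b : V} (ha : a ∈ Δ) (hb : b ∈ Δ) (hab : B a b = 1)
    (hca : c a = 0) (hcb : c b = 0) :
    ∃ L : V →ₗ[ℤ] ℚ, ∀ v, B v a = 0 → B v b = 0 → a + v ∈ Δ → c (a + v) = L v := by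
  set D : Set V := {v | B v a = 0 ∧ B v b = 0 ∧ a + v ∈ Δ} with hD
  have h0D : (0 : V) ∈ D := by simp [hD, ha]
  set Q : V → ℚ → Prop := fun w q ↦ ∀ v ∈ D, ∀ n : ℤ,
    v + (2 * n) • w ∈ D ∧ c (a + (v + (2 * n) • w)) = c (a + v) + 2 * n * q with hQ
  have hQD : ∀ v ∈ D, Q v (c (a + v)) := by
    rintro w ⟨hwa, hwb, hw⟩ v ⟨hva, hvb, hv⟩ n
    obtain ⟨h1, h2⟩ := hc.add_sub_two_mul halt ha hb hab hca hcb hvb hwa hwb hv hw (-n)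
    have h : v - (2 * -n) • w = v + (2 * n) • w := by module
    rw [h] at h1 h2
    refine ⟨⟨by simp [hva, hwa], by simp [hvb, hwb], h1⟩, ?_⟩
    rw [h2]
    push_cast
    ring
  have hQadd : ∀ w w' q q', Q w q → Q w' q' → Q (w + w') (q + q') := by
    intro w w' q q' h h' v hv n
    obtain ⟨h1, h2⟩ := h v hv n
    obtain ⟨h3, h4⟩ := h' _ h1 n
    have e : v + (2 * n) • w + (2 * n) • w' = v + (2 * n) • (w + w') := by module
    rw [e] at h3 h4
    refine ⟨h3, ?_⟩
    rw [h4, h2]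
    ring
  have hQsmul : ∀ (m : ℤ) w q, Q w q → Q (m • w) (m * q) := by
    intro m w q h v hv n
    obtain ⟨h1, h2⟩ := h v hv (n * m)
    have e : v + (2 * (n * m)) • w = v + (2 * n) • m • w := by module
    rw [e] at h1 h2
    refine ⟨h1, ?_⟩
    rw [h2]
    push_cast
    ring
  have hQuniq : ∀ w q q', Q w q → Q w q' → q = q' := by
    intro w q q' h h'
    have h1 := (h 0 h0D 1).2
    have h2 := (h' 0 h0D 1).2
    rw [h1] at h2
    push_cast at h2
    linarith
  let N : Submodule ℤ V :=
    { carrier := {w | ∃ q, Q w q}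
      add_mem' := fun ⟨q, hq⟩ ⟨q', hq'⟩ ↦ ⟨q + q', hQadd _ _ _ _ hq hq'⟩
      zero_mem' := ⟨0, fun v hv n ↦ by simpa using hv⟩
      smul_mem' := fun m w ⟨q, hq⟩ ↦ ⟨m * q, hQsmul m w q hq⟩ }
  choose q hq using fun w : N ↦ w.2
  let f : N →ₗ[ℤ] ℚ :=
    { toFun := q
      map_add' := fun x y ↦ hQuniq _ _ _ (hq (x + y)) (hQadd _ _ _ _ (hq x) (hq y))
      map_smul' := fun m x ↦ by
        rw [RingHom.id_apply, zsmul_eq_mul]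
        exact hQuniq _ _ _ (hq (m • x)) (hQsmul _ _ _ (hq x)) }
  obtain ⟨L, hL⟩ := (Module.Baer.of_divisible ℚ).extension_property N.subtype
    N.injective_subtype f
  refine ⟨L, fun v hva hvb hv ↦ ?_⟩
  have hvD : v ∈ D := ⟨hva, hvb, hv⟩
  have hvN : v ∈ N := ⟨_, hQD v hvD⟩
  have h1 : L v = q ⟨v, hvN⟩ := LinearMap.congr_fun hL ⟨v, hvN⟩
  rw [h1]
  exact hQuniq _ _ _ (hQD v hvD) (hq ⟨v, hvN⟩)

lemma TransvectionCompatible.exists_linear (hc : TransvectionCompatible B Δ c)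
    (halt : ∀ x, B x x = 0)
    (hconn : ∀ G ⊆ Δ, G.Nonempty →
      (∀ η ∈ G, ∀ ε ∈ Δ, ∀ n : ℤ, η - (n * B η ε) • ε ∈ G) → Δ ⊆ G)
    {a b : V} (ha : a ∈ Δ) (hb : b ∈ Δ) (hab : B a b = 1) :
    ∃ L : V →ₗ[ℤ] ℚ, ∀ δ ∈ Δ, c δ = L δ := by
  have hba : B b a = -1 := by rw [← hab, LinearMap.IsAlt.neg halt]
  let Ba : V →ₗ[ℤ] ℤ := B.flip a
  let Bb : V →ₗ[ℤ] ℤ := B.flip b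
  have hBa : ∀ x, Ba x = B x a := fun _ ↦ rfl
  have hBb : ∀ x, Bb x = B x b := fun _ ↦ rfl
  let L₀ : V →ₗ[ℤ] ℚ :=
    (LinearMap.toSpanSingleton ℤ ℚ (c a)).comp Bb - (LinearMap.toSpanSingleton ℤ ℚ (c b)).comp Ba
  have hL₀ : ∀ x, L₀ x = B x b * c a - B x a * c b := fun x ↦ by simp [L₀, hBa, hBb]
  have hc₀ := hc.sub_linear L₀
  have h₀a : c a - L₀ a = 0 := by simp [hL₀, hab, halt]
  have h₀b : c b - L₀ b = 0 := by simp [hL₀, hba, halt]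
  obtain ⟨M, hM⟩ := hc₀.exists_linear_add halt ha hb hab h₀a h₀b
  let π : V →ₗ[ℤ] V := LinearMap.id - (LinearMap.toSpanSingleton ℤ V a).comp Bb
    + (LinearMap.toSpanSingleton ℤ V b).comp Ba
  have hπ : ∀ x, π x = x - B x b • a + B x a • b := fun x ↦ by simp [π, hBa, hBb]
  have hc₁ := hc₀.sub_linear (M.comp π)
  refine ⟨L₀ + M.comp π, fun δ hδ ↦ ?_⟩
  have := hc₁.eq_zero halt hconn ha hb hab ?_ ?_ ?_ hδ
  · rw [LinearMap.add_apply]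
    linarith
  · have : π a = 0 := by simp [hπ, hab, halt]
    simp [this, h₀a]
  · have : π b = 0 := by simp [hπ, hba, halt]
    simp [this, h₀b]
  · intro x hx hxa hxb
    have h1 : π x = x - a := by simp [hπ, hxa, hxb]
    have h2 := hM (x - a) (by simp [hxa, halt]) (by simp [hxb, hab]) (by simpa using hx)
    rw [add_sub_cancel] at h2
    rw [LinearMap.comp_apply, h1, ← h2, sub_self]

end TransvectionCompatible

/-- Over `ℚ`, every linear form is represented by a nondegenerate form, and so is the
coboundary of a linear form on transvections. -/
lemma exists_coboundary_of_linear {V : Type*} [AddCommGroup V] [Module.Free ℤ V]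
    [Module.Finite ℤ V] {B : LinearMap.BilinForm ℤ V} (hnd : B.SeparatingLeft)
    (L : V →ₗ[ℤ] ℚ) :
    ∃ w : ℚ ⊗[ℤ] V, ∀ (T : V →ₗ[ℤ] V) (δ : V), (∀ x, T x = x - B x δ • δ) →
      T.baseChange ℚ w - w = L δ ⊗ₜ[ℤ] δ := by
  classical
  let e := Module.Free.chooseBasis ℤ V
  set M : Matrix _ _ ℤ := LinearMap.toMatrix₂ e e B with hM
  have hdet : M.det ≠ 0 := (LinearMap.separatingLeft_iff_det_ne_zero e).mp hnd
  set N : Matrix _ _ ℚ := M.map (Int.castRingHom ℚ) with hN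
  have hNdet : IsUnit N.det := by
    rw [hN, ← RingHom.mapMatrix_apply, ← RingHom.map_det]
    exact isUnit_iff_ne_zero.mpr (by simpa using hdet)
  set q := Matrix.vecMul (fun j ↦ - L (e j)) N⁻¹ with hq
  have hqN : Matrix.vecMul q N = fun j ↦ - L (e j) := by
    rw [hq, Matrix.vecMul_vecMul, Matrix.nonsing_inv_mul _ hNdet, Matrix.vecMul_one]
  have hL : ∀ δ, ∑ i, q i * (B (e i) δ : ℚ) = - L δ := by
    let F : V →ₗ[ℤ] ℚ := ∑ i, (LinearMap.toSpanSingleton ℤ ℚ (q i)).comp (B (e i))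
    have hF : ∀ δ, F δ = ∑ i, q i * (B (e i) δ : ℚ) := fun δ ↦ by
      simp [F, mul_comm]
    have hFL : F = -L := by
      refine e.ext fun j ↦ ?_
      rw [hF, LinearMap.neg_apply, ← congrFun hqN j]
      simp [Matrix.vecMul, dotProduct, hN, hM, LinearMap.toMatrix₂_apply]
    intro δ
    rw [← hF, hFL, LinearMap.neg_apply]
  refine ⟨∑ i, q i ⊗ₜ[ℤ] e i, fun T δ hT ↦ ?_⟩
  have h1 : ∀ i, T.baseChange ℚ (q i ⊗ₜ[ℤ] e i) - q i ⊗ₜ[ℤ] e i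
      = -((q i * (B (e i) δ : ℚ)) ⊗ₜ[ℤ] δ) := by
    intro i
    rw [LinearMap.baseChange_tmul, hT, TensorProduct.tmul_sub, ← TensorProduct.smul_tmul,
      zsmul_eq_mul, mul_comm, sub_sub_cancel_left]
  rw [map_sum, ← Finset.sum_sub_distrib, Finset.sum_congr rfl fun i _ ↦ h1 i,
    Finset.sum_neg_distrib, ← TensorProduct.sum_tmul, hL, TensorProduct.neg_tmul, neg_neg]

section Monodromy

variable {V : Type*} [AddCommGroup V] {B : LinearMap.BilinForm ℤ V} {Δ : Set V}

/-- The symplectic transvection `x ↦ x - B x δ • δ`. -/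
def transvectionEquiv (halt : ∀ x, B x x = 0) (δ : V) : V ≃ₗ[ℤ] V :=
  LinearEquiv.ofLinearMap (LinearMap.id - (LinearMap.toSpanSingleton ℤ V δ).comp (B.flip δ))
    (LinearMap.id + (LinearMap.toSpanSingleton ℤ V δ).comp (B.flip δ))
    (by ext x; simp [halt]) (by ext x; simp [halt])

lemma transvectionEquiv_apply (halt : ∀ x, B x x = 0) (δ x : V) :
    transvectionEquiv halt δ x = x - B x δ • δ := by
  simp [transvectionEquiv]

lemma transvectionEquiv_symm_apply (halt : ∀ x, B x x = 0) (δ x : V) :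
    (transvectionEquiv halt δ)⁻¹ x = x + B x δ • δ := by
  change (transvectionEquiv halt δ).symm x = _
  simp [transvectionEquiv]

lemma transvectionEquiv_mem (halt : ∀ x, B x x = 0) {δ : V} (hδ : δ ∈ Δ) :
    transvectionEquiv halt δ ∈ monodromyGroup B Δ :=
  Subgroup.subset_closure ⟨δ, hδ, transvectionEquiv_apply halt δ⟩

/-- A subset of `Δ` stable under the powers of all transvections is stable under the monodromy
group. -/
lemma monodromyGroup_apply_mem (halt : ∀ x, B x x = 0) {G : Set V}
    (hG : ∀ η ∈ G, ∀ ε ∈ Δ, ∀ n : ℤ, η - (n * B η ε) • ε ∈ G) {g : V ≃ₗ[ℤ] V}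
    (hg : g ∈ monodromyGroup B Δ) : ∀ η ∈ G, g η ∈ G := by
  suffices h : (∀ η ∈ G, g η ∈ G) ∧ ∀ η ∈ G, g⁻¹ η ∈ G from h.1
  induction hg using Subgroup.closure_induction with
  | mem T hT =>
    obtain ⟨δ, hδ, hT⟩ := hT
    have hT' : T = transvectionEquiv halt δ :=
      LinearEquiv.ext fun x ↦ by rw [hT, transvectionEquiv_apply]
    refine ⟨fun η hη ↦ ?_, fun η hη ↦ ?_⟩
    · simpa [hT] using hG η hη δ hδ 1
    · rw [hT', transvectionEquiv_symm_apply]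
      simpa using hG η hη δ hδ (-1)
  | one => exact ⟨fun η hη ↦ hη, fun η hη ↦ by simpa using hη⟩
  | mul x y _ _ hx hy =>
    refine ⟨fun η hη ↦ hx.1 _ (hy.1 _ hη), fun η hη ↦ ?_⟩
    rw [mul_inv_rev]
    exact hy.2 _ (hx.2 _ hη)
  | inv x _ hx => exact ⟨hx.2, by simpa using hx.1⟩

lemma IsVanishingLattice.subset_of_stable (hΔ : IsVanishingLattice B Δ)
    (halt : ∀ x, B x x = 0) {G : Set V} (hGΔ : G ⊆ Δ) (hne : G.Nonempty)
    (hG : ∀ η ∈ G, ∀ ε ∈ Δ, ∀ n : ℤ, η - (n * B η ε) • ε ∈ G) : Δ ⊆ G := by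
  intro δ hδ
  obtain ⟨η, hη⟩ := hne
  obtain ⟨g, hg, rfl⟩ := hΔ.2.2.1 η (hGΔ hη) δ hδ
  exact monodromyGroup_apply_mem halt hG hg η hη

lemma IsVanishingLattice.ne_zero (hΔ : IsVanishingLattice B Δ) {δ : V} (hδ : δ ∈ Δ) : δ ≠ 0 := by
  obtain ⟨a, ha, b, hb, hab⟩ := hΔ.2.2.2
  obtain ⟨g, -, h⟩ := hΔ.2.2.1 δ hδ a ha
  rintro rfl
  rw [map_zero] at h
  simp [← h] at hab

/-- The transformation law under single transvections implies the one under their powers. -/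
lemma TransvectionCompatible.of_transvection (hΔ : IsVanishingLattice B Δ)
    (halt : ∀ x, B x x = 0) {c : V → ℚ}
    (hc : ∀ ε ∈ Δ, ∀ δ ∈ Δ, c (δ - B δ ε • ε) = c δ - B δ ε * c ε) :
    TransvectionCompatible B Δ c := by
  have hpos : ∀ ε ∈ Δ, ∀ δ ∈ Δ, δ - B δ ε • ε ∈ Δ := fun ε hε δ hδ ↦ by
    rw [← transvectionEquiv_apply halt]
    exact hΔ.2.1 _ (transvectionEquiv_mem halt hε) δ hδ
  have hneg : ∀ ε ∈ Δ, ∀ δ ∈ Δ, δ + B δ ε • ε ∈ Δ := fun ε hε δ hδ ↦ by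
    rw [← transvectionEquiv_symm_apply halt]
    exact hΔ.2.1 _ (inv_mem (transvectionEquiv_mem halt hε)) δ hδ
  rintro ε hε δ hδ n _ _ rfl rfl
  have hB : ∀ m : ℤ, B (δ - m • ε) ε = B δ ε := fun m ↦ by simp [halt]
  induction n using Int.induction_on with
  | zero => simpa using hδ
  | succ n ih =>
    have e : δ - ((n + 1 : ℤ) * B δ ε) • ε = (δ - (n * B δ ε : ℤ) • ε) - B δ ε • ε := by module
    have h1 := hpos ε hε _ ih.1
    have h2 := hc ε hε _ ih.1
    rw [hB] at h1 h2
    rw [e]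
    refine ⟨h1, ?_⟩
    rw [h2, ih.2]
    push_cast
    ring
  | pred n ih =>
    have e : δ - ((-n - 1 : ℤ) * B δ ε) • ε = (δ - (-n * B δ ε : ℤ) • ε) + B δ ε • ε := by module
    have h1 := hneg ε hε _ ih.1
    rw [hB, ← e] at h1
    have h2 := hc ε hε _ h1
    rw [hB, e, add_sub_cancel_right, ← e, ih.2] at h2
    refine ⟨h1, ?_⟩
    push_cast at h2 ⊢
    linarith

lemma tmul_left_injective_of_ne_zero [Module.Free ℤ V] {δ : V} (hδ : δ ≠ 0) {p q : ℚ}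
    (h : p ⊗ₜ[ℤ] δ = q ⊗ₜ[ℤ] δ) : p = q := by
  let e := Module.Free.chooseBasis ℤ V
  obtain ⟨i, hi⟩ : ∃ i, e.repr δ i ≠ 0 := by
    by_contra! h0
    exact hδ (e.repr.map_eq_zero_iff.mp (Finsupp.ext h0))
  have := congrArg (fun x ↦ (e.baseChange ℚ).repr x i) h
  simp only [Module.Basis.baseChange_repr_tmul, zsmul_eq_mul] at this
  exact mul_left_cancel₀ (by exact_mod_cast hi) this

end Monodromy

/-- Let `V` be a free `ℤ`-module of finite rank with a nondegenerate
alternating bilinear form `B`, let `Δ ⊆ V` be a skew-symmetric vanishing lattice, and let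
`Γ = Γ_Δ` be its monodromy group, acting on `V_ℚ = ℚ ⊗ V`.  If `φ : Γ → V_ℚ` is a
1-cocycle such that `φ(T_δ) ∈ ℚ · δ` for every `δ ∈ Δ`, then `φ` is a 1-coboundary. -/
theorem stmt5 {V : Type*} [AddCommGroup V] [Module ℤ V] [Module.Free ℤ V] [Module.Finite ℤ V]
    (B : LinearMap.BilinForm ℤ V) (halt : ∀ x : V, B x x = 0)
    (hnd : ∀ v : V, (∀ x : V, B v x = 0) → v = 0)
    (Δ : Set V) (hΔ : IsVanishingLattice B Δ)
    (φ : monodromyGroup B Δ → ℚ ⊗[ℤ] V)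
    (hcocycle : ∀ x y : monodromyGroup B Δ,
      φ (x * y) = LinearMap.baseChange ℚ (x : V ≃ₗ[ℤ] V).toLinearMap (φ y) + φ x)
    (hδ : ∀ δ ∈ Δ, ∀ T : monodromyGroup B Δ,
      (∀ x : V, (T : V ≃ₗ[ℤ] V) x = x - B x δ • δ) →
      ∃ c : ℚ, φ T = c ⊗ₜ[ℤ] δ) :
    ∃ w : ℚ ⊗[ℤ] V, ∀ x : monodromyGroup B Δ,
      φ x = LinearMap.baseChange ℚ (x : V ≃ₗ[ℤ] V).toLinearMap w - w := by
  rename_i inst _ _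
  obtain rfl : inst = AddCommGroup.toIntModule V := Subsingleton.elim _ _
  let T : Δ → monodromyGroup B Δ := fun δ ↦
    ⟨transvectionEquiv halt δ.1, transvectionEquiv_mem halt δ.2⟩
  have hT : ∀ (δ : Δ) (x : V), (T δ : V ≃ₗ[ℤ] V) x = x - B x δ • (δ : V) := fun δ x ↦
    transvectionEquiv_apply halt _ x
  choose c₀ hc₀ using fun δ : Δ ↦ hδ δ δ.2 (T δ) (hT δ)
  classical
  let c : V → ℚ := fun x ↦ if h : x ∈ Δ then c₀ ⟨x, h⟩ else 0
  have hφ : ∀ δ : Δ, φ (T δ) = c δ ⊗ₜ[ℤ] (δ : V) := fun δ ↦ by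
    rw [hc₀]
    simp [c]
  have hc : TransvectionCompatible B Δ c := by
    refine .of_transvection hΔ halt fun ε hε δ hδ' ↦ ?_
    have hmem : δ - B δ ε • ε ∈ Δ := by
      rw [← transvectionEquiv_apply halt]
      exact hΔ.2.1 _ (transvectionEquiv_mem halt hε) δ hδ'
    set δ' := δ - B δ ε • ε with hδ'_def
    have hBδ' : ∀ x, B x δ' = B x δ - B δ ε * B x ε := fun x ↦ by simp [hδ'_def]
    have hεδ : B ε δ = - B δ ε := (LinearMap.IsAlt.neg halt δ ε).symm
    have hconj : T ⟨δ', hmem⟩ * T ⟨ε, hε⟩ = T ⟨ε, hε⟩ * T ⟨δ, hδ'⟩ := by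
      refine Subtype.ext (LinearEquiv.ext fun x ↦ ?_)
      simp only [Subgroup.coe_mul, LinearEquiv.mul_apply, hT]
      simp only [map_sub, LinearMap.sub_apply, map_zsmul, LinearMap.smul_apply, halt, hεδ,
        smul_eq_mul, hδ'_def]
      module
    have h1 := congrArg φ hconj
    rw [hcocycle, hcocycle, hφ, hφ, hφ, LinearMap.baseChange_tmul, LinearMap.baseChange_tmul,
      LinearEquiv.coe_coe, LinearEquiv.coe_coe, hT, hT] at h1
    simp only [hBδ', halt, hεδ, ← hδ'_def, TensorProduct.tmul_sub, mul_zero, sub_zero,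
      ← TensorProduct.smul_tmul, zsmul_eq_mul] at h1
    have h2 : c δ' ⊗ₜ[ℤ] δ' = (c δ - B δ ε * c ε) ⊗ₜ[ℤ] δ' := by
      rw [TensorProduct.sub_tmul, eq_sub_iff_add_eq]
      rw [Int.cast_neg, neg_mul, TensorProduct.neg_tmul] at h1
      have := congrArg (· - c ε ⊗ₜ[ℤ] ε) h1
      simp only [add_sub_cancel_right] at this
      rw [← this]
      abel
    exact tmul_left_injective_of_ne_zero (hΔ.ne_zero hmem) h2
  obtain ⟨a, ha, b, hb, hab⟩ := hΔ.2.2.2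
  obtain ⟨L, hL⟩ := hc.exists_linear halt
    (fun G hG hne h ↦ hΔ.subset_of_stable halt hG hne h) ha hb hab
  obtain ⟨w, hw⟩ := exists_coboundary_of_linear hnd L
  refine ⟨w, ?_⟩
  have hcomp : ∀ (x y : monodromyGroup B Δ) (z : ℚ ⊗[ℤ] V),
      LinearMap.baseChange ℚ ((x * y : monodromyGroup B Δ) : V ≃ₗ[ℤ] V).toLinearMap z =
        LinearMap.baseChange ℚ (x : V ≃ₗ[ℤ] V).toLinearMap
          (LinearMap.baseChange ℚ (y : V ≃ₗ[ℤ] V).toLinearMap z) := fun x y z ↦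
    LinearMap.congr_fun (LinearMap.baseChange_comp (A := ℚ)
      (y : V ≃ₗ[ℤ] V).toLinearMap (x : V ≃ₗ[ℤ] V).toLinearMap) z
  have hone : ∀ z : ℚ ⊗[ℤ] V,
      LinearMap.baseChange ℚ ((1 : monodromyGroup B Δ) : V ≃ₗ[ℤ] V).toLinearMap z = z := fun z ↦
    LinearMap.congr_fun (LinearMap.baseChange_id (A := ℚ) (M := V)) z
  have hφ1 : φ 1 = 0 := by
    have h1 := hcocycle 1 1
    rw [mul_one, hone] at h1
    simpa using h1
  rintro ⟨g, hg⟩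
  induction hg using Subgroup.closure_induction with
  | mem S hS =>
    obtain ⟨δ, hδΔ, hS'⟩ := hS
    have hST : (⟨S, Subgroup.subset_closure ⟨δ, hδΔ, hS'⟩⟩ : monodromyGroup B Δ) = T ⟨δ, hδΔ⟩ :=
      Subtype.ext (LinearEquiv.ext fun x ↦ by rw [hT]; exact hS' x)
    rw [hw S.toLinearMap δ hS', hST, hφ, hL δ hδΔ]
  | one => exact hφ1.trans (sub_eq_zero.mpr (hone w)).symm
  | mul x y hx hy ihx ihy =>
    have h1 := hcocycle ⟨x, hx⟩ ⟨y, hy⟩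
    have h2 := hcomp ⟨x, hx⟩ ⟨y, hy⟩ w
    rw [ihx, ihy, map_sub] at h1
    refine h1.trans ?_
    rw [← h2, sub_add_sub_cancel]
    rfl
  | inv x hx ihx =>
    have h1 := hcocycle ⟨x, hx⟩⁻¹ ⟨x, hx⟩
    have h2 := hcomp ⟨x, hx⟩⁻¹ ⟨x, hx⟩ w
    rw [inv_mul_cancel, hone] at h2
    rw [inv_mul_cancel, hφ1, ihx, map_sub, ← h2] at h1
    refine (eq_neg_of_add_eq_zero_right h1.symm).trans ?_
    rw [neg_sub]
    rfl
end

section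
/- Let V be a free ℤ-module with an alternating bilinear form B, let r ≥ 2, and let δ₁,…,δ_r ∈ V be linearly independent elements satisfying B(δ₁,δᵢ) = 1 for all i = 2,…,r. Let V' be the ℤ-span of δ₁,…,δ_r (a free module of rank r, preserved by each transvection T_{δᵢ}), and let Γ' be the subgroup of automorphisms of V' generated by the restrictions of T_{δ₁},…,T_{δ_r}. Then T_{δᵢ}(T_{δ₁}(δᵢ)) = δ₁ for every i ≥ 2, so that δ₁,…,δ_r all lie in a single orbit of Γ', and the orbit set Δ' = Γ' · {δ₁,…,δ_r} is a skew-symmetric vanishing lattice in V'. -/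
section VanishingLattice

variable {V : Type*} [AddCommGroup V] [Module ℤ V] {B : LinearMap.BilinForm ℤ V}

theorem exists_transvection (halt : ∀ x : V, B x x = 0) (v : V) :
    ∃ T : V ≃ₗ[ℤ] V, ∀ x, T x = x - B x v • v := by
  refine ⟨LinearEquiv.ofLinearMap (LinearMap.id - LinearMap.toSpanSingleton ℤ V v ∘ₗ B.flip v)
    (LinearMap.id + LinearMap.toSpanSingleton ℤ V v ∘ₗ B.flip v) ?_ ?_, fun x => ?_⟩
  · ext x; simp [halt]
  · ext x; simp [halt]
  · exact congrArg (x - ·) (int_smul_eq_zsmul _ (B x v) v)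

theorem monodromyGroup_mono {Δ₁ Δ₂ : Set V} (h : Δ₁ ⊆ Δ₂) :
    monodromyGroup B Δ₁ ≤ monodromyGroup B Δ₂ :=
  Subgroup.closure_mono fun _ ⟨v, hv, hT⟩ => ⟨v, h hv, hT⟩

theorem exists_mem_monodromyGroup (halt : ∀ x : V, B x x = 0) {Δ : Set V} {v : V} (hv : v ∈ Δ) :
    ∃ T ∈ monodromyGroup B Δ, ∀ x, T x = x - B x v • v := by
  obtain ⟨T, hT⟩ := exists_transvection halt v
  exact ⟨T, Subgroup.subset_closure ⟨v, hv, hT⟩, hT⟩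

theorem bilin_map_map_of_mem_monodromyGroup (halt : ∀ x : V, B x x = 0) {Δ : Set V}
    {g : V ≃ₗ[ℤ] V} (hg : g ∈ monodromyGroup B Δ) (x y : V) : B (g x) (g y) = B x y := by
  induction hg using Subgroup.closure_induction generalizing x y with
  | mem T hT =>
    obtain ⟨v, -, hT⟩ := hT
    have hskew : B v y = -B y v := (LinearMap.IsAlt.neg (B := B) halt y v).symm
    simp [hT, halt, hskew]
    ring
  | one => rfl
  | mul a b _ _ ha hb => simp only [LinearEquiv.mul_apply, ha, hb]
  | inv a _ ha => rw [← ha, ← LinearEquiv.mul_apply, ← LinearEquiv.mul_apply, mul_inv_cancel]; rfl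

theorem monodromyGroup_orbit_le (halt : ∀ x : V, B x x = 0) {ι : Type*} (δ : ι → V) :
    monodromyGroup B {v | ∃ g ∈ monodromyGroup B (Set.range δ), ∃ i, g (δ i) = v} ≤
      monodromyGroup B (Set.range δ) := by
  refine (Subgroup.closure_le _).2 ?_
  rintro T ⟨_, ⟨g, hg, i, rfl⟩, hT⟩
  obtain ⟨S, hS, hSx⟩ := exists_mem_monodromyGroup halt (Set.mem_range_self (f := δ) i)
  have hconj : T = g * S * g⁻¹ := by
    ext x
    obtain ⟨y, rfl⟩ := g.surjective x
    have hy : g⁻¹ (g y) = y := g.symm_apply_apply y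
    simp [hT, hSx, hy, bilin_map_map_of_mem_monodromyGroup halt hg]
  rw [hconj]
  exact mul_mem (mul_mem hg hS) (inv_mem hg)

theorem isVanishingLattice_orbit (halt : ∀ x : V, B x x = 0) {ι : Type*} (δ : ι → V)
    (hspan : Submodule.span ℤ (Set.range δ) = ⊤)
    (horb : ∀ i j, ∃ g ∈ monodromyGroup B (Set.range δ), g (δ i) = δ j)
    (hone : ∃ i j, B (δ i) (δ j) = 1) :
    IsVanishingLattice B {v | ∃ g ∈ monodromyGroup B (Set.range δ), ∃ i, g (δ i) = v} := by
  have hmem : ∀ i, δ i ∈ {v | ∃ g ∈ monodromyGroup B (Set.range δ), ∃ i, g (δ i) = v} :=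
    fun i => ⟨1, one_mem _, i, rfl⟩
  have hsub := Set.range_subset_iff.2 hmem
  refine ⟨top_le_iff.1 (hspan ▸ Submodule.span_mono hsub), ?_, ?_, ?_⟩
  · rintro g hg _ ⟨h, hh, i, rfl⟩
    exact ⟨g * h, mul_mem (monodromyGroup_orbit_le halt δ hg) hh, i, rfl⟩
  · rintro _ ⟨g, hg, i, rfl⟩ _ ⟨h, hh, j, rfl⟩
    obtain ⟨k, hk, hkij⟩ := horb i j
    refine ⟨h * k * g⁻¹, monodromyGroup_mono hsub (mul_mem (mul_mem hh hk) (inv_mem hg)), ?_⟩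
    have hi : g⁻¹ (g (δ i)) = δ i := g.symm_apply_apply _
    simp [hi, hkij]
  · obtain ⟨i, j, hij⟩ := hone
    exact ⟨δ i, hmem i, δ j, hmem j, hij⟩

theorem transvection_transvection_eq (halt : ∀ x : V, B x x = 0) {v w : V} (hvw : B v w = 1)
    {S T : V ≃ₗ[ℤ] V} (hS : ∀ x, S x = x - B x v • v) (hT : ∀ x, T x = x - B x w • w) :
    T (S w) = v := by
  have hskew : B w v = -1 := by rw [← hvw]; exact (LinearMap.IsAlt.neg (B := B) halt v w).symm
  simp [hS, hT, hskew, hvw, halt]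

theorem exists_mem_monodromyGroup_apply_eq (halt : ∀ x : V, B x x = 0) {ι : Type*} {δ : ι → V}
    {i₀ : ι} (hpair : ∀ i, i ≠ i₀ → B (δ i₀) (δ i) = 1) (i j : ι) :
    ∃ g ∈ monodromyGroup B (Set.range δ), g (δ i) = δ j := by
  have hbase : ∀ i, ∃ g ∈ monodromyGroup B (Set.range δ), g (δ i) = δ i₀ := by
    intro i
    by_cases hi : i = i₀
    · exact ⟨1, one_mem _, by rw [hi]; rfl⟩
    · obtain ⟨S, hS, hSx⟩ := exists_mem_monodromyGroup halt (Set.mem_range_self (f := δ) i₀)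
      obtain ⟨T, hT, hTx⟩ := exists_mem_monodromyGroup halt (Set.mem_range_self (f := δ) i)
      exact ⟨T * S, mul_mem hT hS, transvection_transvection_eq halt (hpair i hi) hSx hTx⟩
  obtain ⟨g, hg, hgi⟩ := hbase i
  obtain ⟨h, hh, hhj⟩ := hbase j
  refine ⟨h⁻¹ * g, mul_mem (inv_mem hh) hg, ?_⟩
  rw [LinearEquiv.mul_apply, hgi, ← hhj]
  exact h.symm_apply_apply _

end VanishingLattice

/-- Let `V` be a free `ℤ`-module with an alternating bilinear form `B`,
let `r ≥ 2`, and let `δ₁, …, δ_r ∈ V` be linearly independent with `B(δ₁, δᵢ) = 1` for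
`i = 2, …, r`.  Let `V'` be the `ℤ`-span of the `δᵢ` (a free module of rank `r`,
preserved by each transvection `T_{δᵢ}`), with the restricted form `B'`, and let `Γ'` be
the subgroup of automorphisms of `V'` generated by the restricted transvections.  Then
`T_{δᵢ}(T_{δ₁}(δᵢ)) = δ₁` for every `i ≥ 2`, so the `δᵢ` all lie in a single `Γ'`-orbit,
and `Δ' = Γ' · {δ₁, …, δ_r}` is a skew-symmetric vanishing lattice in `V'`. -/
theorem stmt7 {V : Type*} [AddCommGroup V] [Module ℤ V] [Module.Free ℤ V]
    (B : LinearMap.BilinForm ℤ V) (halt : ∀ x : V, B x x = 0)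
    (r : ℕ) (hr : 2 ≤ r) (i₀ : Fin r) (hi₀ : (i₀ : ℕ) = 0) (δ : Fin r → V) (hind : LinearIndependent ℤ δ)
    (hpair : ∀ i : Fin r, i ≠ i₀ → B (δ i₀) (δ i) = 1)
    (V' : Submodule ℤ V) (hV' : V' = Submodule.span ℤ (Set.range δ))
    (δ' : Fin r → V') (hδ' : ∀ i, (δ' i : V) = δ i)
    (B' : LinearMap.BilinForm ℤ V') (hB' : ∀ x y : V', B' x y = B (x : V) (y : V)) :
    Module.Free ℤ V' ∧ Module.finrank ℤ V' = r ∧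
    (∀ (i : Fin r), ∀ x ∈ V', x - B x (δ i) • δ i ∈ V') ∧
    (∀ i : Fin r, i ≠ i₀ → ∀ T₀ Tᵢ : V ≃ₗ[ℤ] V,
      (∀ x, T₀ x = x - B x (δ i₀) • δ i₀) →
      (∀ x, Tᵢ x = x - B x (δ i) • δ i) →
      Tᵢ (T₀ (δ i)) = δ i₀) ∧
    (∀ i j : Fin r, ∃ g ∈ monodromyGroup B' (Set.range δ'), g (δ' i) = δ' j) ∧
    IsVanishingLattice B'
      {v : V' | ∃ g ∈ monodromyGroup B' (Set.range δ'), ∃ i : Fin r, g (δ' i) = v} := by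
  subst hV'
  have hδ : ∀ i, δ i ∈ Submodule.span ℤ (Set.range δ) := fun i =>
    Submodule.subset_span (Set.mem_range_self i)
  have hmod : AddCommGroup.toIntModule (Submodule.span ℤ (Set.range δ)) =
      (Submodule.span ℤ (Set.range δ)).module := Subsingleton.elim _ _
  have halt' : ∀ x, B' x x = 0 := fun x => by rw [hB', halt]
  have hpair' : ∀ i, i ≠ i₀ → B' (δ' i₀) (δ' i) = 1 := fun i hi => by
    rw [hB', hδ', hδ', hpair i hi]
  have horb := exists_mem_monodromyGroup_apply_eq halt' hpair'
  have hspan : Submodule.span ℤ (Set.range δ') = ⊤ := by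
    have hrange : Set.range δ' = (↑) ⁻¹' Set.range δ := by
      ext x
      simp only [Set.mem_range, Set.mem_preimage, Subtype.ext_iff, hδ']
    rw [hrange, hmod]
    exact Submodule.span_span_coe_preimage
  refine ⟨?_, ?_, fun i x hx =>
      sub_mem hx (zsmul_mem (hδ i) _), fun i hi T₀ Tᵢ hT₀ hTᵢ =>
      transvection_transvection_eq halt (hpair i hi) hT₀ hTᵢ, horb,
      isVanishingLattice_orbit halt' δ' hspan horb ?_⟩
  · rw [hmod]
    exact @Module.Free.of_basis _ _ _ _ (_) _ (Module.Basis.span hind)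
  · rw [hmod]
    exact (finrank_span_eq_card hind).trans (Fintype.card_fin r)
  · refine ⟨i₀, ⟨1, hr⟩, hpair' _ fun h => ?_⟩
    rw [← h] at hi₀
    exact one_ne_zero hi₀
end

section
/- Let V be a free ℤ-module of finite rank with an alternating bilinear form B, let V' ⊆ V be a submodule of finite index, and let g ∈ Sp♯(V) be an automorphism satisfying g(V') = V'. Then there exists an integer m ≥ 1 such that the restriction of gᵐ to V' belongs to Sp♯₂(V'), where V' carries the restriction of the form B. -/
/-- Some positive power of an automorphism of a finite free `ℤ`-module is the identity
modulo `k`. -/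
theorem exists_pow_eq_add_smul {V : Type*} [AddCommGroup V] [Module.Free ℤ V]
    [Module.Finite ℤ V] (g : V ≃ₗ[ℤ] V) (k : ℕ) [NeZero k] :
    ∃ m : ℕ, 1 ≤ m ∧ ∀ v : V, ∃ w : V, (g ^ m) v = v + (k : ℤ) • w := by
  let b := Module.Free.chooseBasis ℤ V
  let f : ℕ → Module.Free.ChooseBasisIndex ℤ V → Module.Free.ChooseBasisIndex ℤ V → ZMod k :=
    fun n j i => ((b.repr ((g ^ n) (b j)) i : ℤ) : ZMod k)
  obtain ⟨n₁, n₂, hlt, heq⟩ : ∃ n₁ n₂, n₁ < n₂ ∧ f n₁ = f n₂ := by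
    obtain ⟨x, y, hne, h⟩ := Finite.exists_ne_map_eq_of_infinite f
    rcases lt_or_gt_of_ne hne with hxy | hxy
    · exact ⟨x, y, hxy, h⟩
    · exact ⟨y, x, hxy, h.symm⟩
  have hbasis : ∀ j, ∃ w : V, (g ^ n₂) (b j) = (g ^ n₁) (b j) + (k : ℤ) • w := by
    intro j
    have hdvd : ∀ i, ∃ c : ℤ,
        b.repr ((g ^ n₂) (b j)) i - b.repr ((g ^ n₁) (b j)) i = k * c := fun i =>
      (ZMod.intCast_eq_intCast_iff_dvd_sub _ _ k).1 (congrFun (congrFun heq j) i)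
    choose c hc using hdvd
    refine ⟨∑ i, c i • b i, b.ext_elem fun i => ?_⟩
    have hci : b.repr (∑ i, c i • b i) i = c i := by
      exact congrFun (b.repr_sum_self c) i
    rw [map_add, map_smul, Finsupp.add_apply, Finsupp.smul_apply, hci, smul_eq_mul]
    linarith [hc i]
  choose w hw using hbasis
  have hall : ∀ v, (g ^ n₂) v = (g ^ n₁) v + (k : ℤ) • b.constr ℤ w v := by
    have hlin : ((g ^ n₂ : V ≃ₗ[ℤ] V) : V →ₗ[ℤ] V) =
        ((g ^ n₁ : V ≃ₗ[ℤ] V) : V →ₗ[ℤ] V) + (k : ℤ) • b.constr ℤ w :=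
      b.ext fun j => by simp [hw j]
    exact fun v => LinearMap.congr_fun hlin v
  refine ⟨n₂ - n₁, by omega, fun v => ⟨b.constr ℤ w ((g ^ n₁).symm v), ?_⟩⟩
  have h := hall ((g ^ n₁).symm v)
  rw [← Nat.sub_add_cancel hlt.le, pow_add, LinearEquiv.mul_apply,
    LinearEquiv.apply_symm_apply] at h
  exact h

theorem isometry_pow {V : Type*} [AddCommGroup V] (B : LinearMap.BilinForm ℤ V)
    (g : V ≃ₗ[ℤ] V) (hg : ∀ x y : V, B (g x) (g y) = B x y) (n : ℕ) (x y : V) :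
    B ((g ^ n) x) ((g ^ n) y) = B x y := by
  induction n with
  | zero => simp
  | succ n ih => rw [pow_succ', LinearEquiv.mul_apply, LinearEquiv.mul_apply, hg, ih]

theorem apply_isometry_eq_symm_apply {V : Type*} [AddCommGroup V]
    (B : LinearMap.BilinForm ℤ V) (g : V ≃ₗ[ℤ] V) (hg : ∀ x y : V, B (g x) (g y) = B x y)
    (x y : V) : B x (g y) = B (g.symm x) y := by
  rw [← hg (g.symm x), LinearEquiv.apply_symm_apply]

/-- `Sp♯` is closed under powers. -/
theorem sharp_pow {V : Type*} [AddCommGroup V] (B : LinearMap.BilinForm ℤ V)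
    (g : V ≃ₗ[ℤ] V) (hg : ∀ x y : V, B (g x) (g y) = B x y) (lam : V →ₗ[ℤ] ℤ)
    (hlam : ∃ v : V, ∀ x : V, lam (g x - x) = B v x) (n : ℕ) :
    ∃ v : V, ∀ x : V, lam ((g ^ n) x - x) = B v x := by
  obtain ⟨v, hv⟩ := hlam
  induction n with
  | zero => exact ⟨0, fun x => by simp⟩
  | succ n ih =>
    obtain ⟨w, hw⟩ := ih
    refine ⟨g.symm w + v, fun x => ?_⟩
    rw [pow_succ, LinearEquiv.mul_apply, map_add, LinearMap.add_apply,
      ← apply_isometry_eq_symm_apply B g hg, ← hw, ← hv, ← map_add]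
    congr 1
    abel

/-- If an isometry `u` is the identity modulo `k` and `λ ∘ (u - 1) = j(v)`, then
`λ ∘ (uᵗ - 1)` is congruent to `t j(v)` modulo `k j(V)`. -/
theorem pow_sub_eq_mul_add {V : Type*} [AddCommGroup V]
    (B : LinearMap.BilinForm ℤ V) (u : V ≃ₗ[ℤ] V) (hu : ∀ x y : V, B (u x) (u y) = B x y)
    (k : ℤ) (hk : ∀ v : V, ∃ w : V, u v = v + k • w) (lam : V →ₗ[ℤ] ℤ) (v : V)
    (hv : ∀ x : V, lam (u x - x) = B v x) (t : ℕ) :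
    ∃ w : V, ∀ x : V, lam ((u ^ t) x - x) = t * B v x + k * B w x := by
  obtain ⟨w₀, hw₀⟩ := hk (u.symm v)
  rw [LinearEquiv.apply_symm_apply] at hw₀
  have hshift : ∀ x, B v (u x) = B v x - k * B w₀ x := by
    intro x
    have h : B v x = B (u.symm v + k • w₀) x := by rw [← hw₀]
    rw [map_add, map_smul, LinearMap.add_apply, LinearMap.smul_apply, smul_eq_mul] at h
    rw [apply_isometry_eq_symm_apply B u hu]
    linarith
  induction t with
  | zero => exact ⟨0, fun x => by simp⟩
  | succ t ih =>
    obtain ⟨w, hw⟩ := ih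
    refine ⟨u.symm w - (t : ℤ) • w₀, fun x => ?_⟩
    have hsplit : (u ^ (t + 1)) x - x = ((u ^ t) (u x) - u x) + (u x - x) := by
      rw [pow_succ, LinearEquiv.mul_apply]
      abel
    rw [hsplit, map_add, hw, hv, hshift, map_sub, map_smul, LinearMap.sub_apply,
      LinearMap.smul_apply, smul_eq_mul, ← apply_isometry_eq_symm_apply B u hu]
    push_cast
    ring

/-- For every `k ≥ 1`, an element of `Sp♯(V)` has a positive power that acts trivially on
`Hom(V,ℤ)/j(kV)`. -/
theorem exists_pow_sub_eq_mul {V : Type*} [AddCommGroup V] [Module.Free ℤ V]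
    [Module.Finite ℤ V] (B : LinearMap.BilinForm ℤ V) (g : V ≃ₗ[ℤ] V)
    (hSp : ∀ x y : V, B (g x) (g y) = B x y)
    (hSharp : ∀ lam : V →ₗ[ℤ] ℤ, ∃ v : V, ∀ x : V, lam (g x - x) = B v x)
    (k : ℕ) (hk : 1 ≤ k) :
    ∃ m : ℕ, 1 ≤ m ∧ ∀ lam : V →ₗ[ℤ] ℤ, ∃ v : V, ∀ x : V,
      lam ((g ^ m) x - x) = k * B v x := by
  have : NeZero k := ⟨by omega⟩
  obtain ⟨m, hm, hmod⟩ := exists_pow_eq_add_smul g k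
  refine ⟨m * k, Nat.mul_pos hm hk, fun lam => ?_⟩
  obtain ⟨v, hv⟩ := sharp_pow B g hSp lam (hSharp lam) m
  obtain ⟨w, hw⟩ := pow_sub_eq_mul_add B (g ^ m) (isometry_pow B g hSp m) k hmod lam v hv k
  refine ⟨v + w, fun x => ?_⟩
  rw [pow_mul, hw, map_add, LinearMap.add_apply, mul_add]

theorem map_pow_eq_self {V : Type*} [AddCommGroup V] (V' : Submodule ℤ V)
    (g : V ≃ₗ[ℤ] V) (hinv : Submodule.map (g : V →ₗ[ℤ] V) V' = V') (m : ℕ) :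
    Submodule.map ((g ^ m : V ≃ₗ[ℤ] V) : V →ₗ[ℤ] V) V' = V' := by
  induction m with
  | zero => exact Submodule.map_id V'
  | succ m ih =>
    have hcomp : ((g ^ (m + 1) : V ≃ₗ[ℤ] V) : V →ₗ[ℤ] V) =
        ((g ^ m : V ≃ₗ[ℤ] V) : V →ₗ[ℤ] V) ∘ₗ (g : V →ₗ[ℤ] V) := by
      ext x
      simp [pow_succ]
    rw [hcomp, Submodule.map_comp, hinv, ih]

/-- Let `V` be a free `ℤ`-module of finite rank with an alternating
bilinear form `B`, let `V' ⊆ V` be a submodule of finite index, and let `g ∈ Sp♯(V)`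
be an automorphism with `g(V') = V'`.  Then there exists an integer `m ≥ 1` such that
the restriction of `gᵐ` to `V'` belongs to `Sp♯₂(V')`, where `V'` carries the
restriction of the form `B`: that is, there is an automorphism `h` of `V'` agreeing
with `gᵐ`, preserving the restricted form, such that for every `λ ∈ Hom(V',ℤ)` there
exists `v ∈ V'` with `λ(h x − x) = 2·B(v,x)` for all `x ∈ V'`. -/
theorem stmt8 {V : Type*} [AddCommGroup V] [Module ℤ V] [Module.Free ℤ V] [Module.Finite ℤ V]
    (B : LinearMap.BilinForm ℤ V) (halt : ∀ x : V, B x x = 0)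
    (V' : Submodule ℤ V) (hfin : Finite (V ⧸ V'))
    (g : V ≃ₗ[ℤ] V)
    (hSp : ∀ x y : V, B (g x) (g y) = B x y)
    (hSharp : ∀ lam : V →ₗ[ℤ] ℤ, ∃ v : V, ∀ x : V, lam (g x - x) = B v x)
    (hinv : Submodule.map (g : V →ₗ[ℤ] V) V' = V') :
    ∃ m : ℕ, 1 ≤ m ∧ ∃ h : V' ≃ₗ[ℤ] V',
      (∀ x : V', (h x : V) = (g ^ m) (x : V)) ∧
      (∀ x y : V', B (h x : V) (h y : V) = B (x : V) (y : V)) ∧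
      (∀ lam : V' →ₗ[ℤ] ℤ, ∃ v : V', ∀ x : V',
        lam (h x - x) = 2 * B (v : V) (x : V)) := by
  rename_i instV _ _
  obtain rfl : instV = AddCommGroup.toIntModule V := Subsingleton.elim _ _
  let N := Nat.card (V ⧸ V')
  have hN : 0 < N := Nat.card_pos
  have hmem : ∀ v : V, (N : ℤ) • v ∈ V' := by
    intro v
    rw [← Submodule.Quotient.mk_eq_zero, Submodule.Quotient.mk_smul, Nat.cast_smul_eq_nsmul]
    exact card_nsmul_eq_zero'
  obtain ⟨m, hm, hpow⟩ :=
    exists_pow_sub_eq_mul B g hSp hSharp (2 * N * N) (by nlinarith [Nat.mul_pos hN hN])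
  refine ⟨m, hm, (g ^ m).ofSubmodules V' V' (map_pow_eq_self V' g hinv m), fun x => rfl,
    fun x y => isometry_pow B g hSp m x y, fun lam => ?_⟩
  let mulN : V →ₗ[ℤ] V' := LinearMap.codRestrict V' ((N : ℤ) • LinearMap.id) hmem
  obtain ⟨v, hv⟩ := hpow (lam ∘ₗ mulN)
  refine ⟨mulN v, fun x => ?_⟩
  set y := (g ^ m).ofSubmodules V' V' (map_pow_eq_self V' g hinv m) x - x
  have hmul : mulN ((g ^ m) (x : V) - x) = (N : ℤ) • y := rfl
  have hvx := hv x
  rw [LinearMap.comp_apply, hmul, map_smul, smul_eq_mul] at hvx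
  have hform : B (mulN v : V) (x : V) = N * B v x := by
    change B ((N : ℤ) • v) x = _
    rw [map_smul, LinearMap.smul_apply, smul_eq_mul]
  rw [hform]
  have hN' : (N : ℤ) ≠ 0 := by exact_mod_cast hN.ne'
  apply mul_left_cancel₀ hN'
  rw [hvx]
  push_cast
  ring
end

section
/- Let Γ be a group acting ℚ-linearly on a ℚ-vector space V, let Γ' ⊆ Γ be a subgroup of finite index, and let T ⊆ Γ be a generating set of Γ. Suppose φ : Γ → V is a 1-cocycle such that φ vanishes identically on Γ' and such that γ · φ(γ) = φ(γ) for every γ ∈ T. Then φ = 0. -/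
/-- Let `Γ` be a group acting `ℚ`-linearly on a `ℚ`-vector space `V`,
let `Γ' ⊆ Γ` be a subgroup of finite index, and let `T ⊆ Γ` be a generating set of `Γ`.
If `φ : Γ → V` is a 1-cocycle vanishing identically on `Γ'` and with `γ · φ(γ) = φ(γ)`
for every `γ ∈ T`, then `φ = 0`. -/
theorem stmt11 (Γ : Type*) [Group Γ] (V : Type*) [AddCommGroup V] [Module ℚ V]
    (ρ : Γ →* Module.End ℚ V)
    (Γ' : Subgroup Γ) (hfin : Γ'.index ≠ 0)
    (T : Set Γ) (hgen : Subgroup.closure T = ⊤)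
    (φ : Γ → V)
    (hcocycle : ∀ x y : Γ, φ (x * y) = ρ x (φ y) + φ x)
    (hΓ' : ∀ x ∈ Γ', φ x = 0)
    (hT : ∀ γ ∈ T, ρ γ (φ γ) = φ γ) :
    ∀ x : Γ, φ x = 0 := by
  have h_one : φ 1 = 0 := hΓ' 1 Γ'.one_mem
  have h_gen : ∀ γ ∈ T, φ γ = 0 := by
    intro γ hγ
    have h_pow : ∀ n : ℕ, φ (γ ^ n) = n • φ γ := by
      intro n
      induction n with
      | zero => simpa using h_one
      | succ n ih => rw [pow_succ', hcocycle, ih, map_nsmul, hT γ hγ, succ_nsmul]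
    obtain ⟨n, hn, -, hmem⟩ := Γ'.exists_pow_mem_of_index_ne_zero hfin γ
    have h_zero : (n : ℚ) • φ γ = 0 := by
      rw [Nat.cast_smul_eq_nsmul, ← h_pow, hΓ' _ hmem]
    exact (smul_eq_zero.mp h_zero).resolve_left (Nat.cast_ne_zero.mpr hn.ne')
  intro x
  have hx : x ∈ Subgroup.closure T := hgen ▸ Subgroup.mem_top x
  induction hx using Subgroup.closure_induction with
  | mem γ hγ => exact h_gen γ hγ
  | one => exact h_one
  | mul y z _ _ hy hz => rw [hcocycle, hy, hz, map_zero, add_zero]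
  | inv y _ hy => simpa [h_one, hy] using (hcocycle y⁻¹ y).symm
end
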